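/- arXiv:1502.03654 — 2 statements merged into one kernel-verified Lean document; each statement's English description precedes it below -/
import Mathlib

section
/- Fix α > 0 and β ≥ 1. For each K, let M = M(K) with M(K) → ∞ and M(K)/K → β as K → ∞, let H_K ∈ ℂ^{K×M} be a random matrix with i.i.d. CN(0,1) entries, and set Q_K ≜ ( H_K^H H_K / M + α·I_M )^{-1}. Let δ be the unique nonnegative solution of δ = 1/(α + 1/(β(1+δ))) and set Q_o ≜ ( α + 1/(β(1+δ)) )^{-1} · I_M. Let (U_M) be a sequence of deterministic M×M complex matrices with uniformly bounded spectral norm, i.e. sup_K ‖U_{M(K)}‖₂ < ∞. Then (1/M)·tr(U_M Q_K) − (1/M)·tr(U_M Q_o) → 0 almost surely as K → ∞. -/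
open MeasureTheory ProbabilityTheory Filter Matrix

/-- The standard complex Gaussian distribution `CN(0,1)`: real and imaginary
parts are independent `N(0, 1/2)`. -/
noncomputable def stdCGaussian : Measure ℂ :=
  Measure.map (fun p : ℝ × ℝ => (p.1 : ℂ) + (p.2 : ℂ) * Complex.I)
    ((gaussianReal 0 (1/2)).prod (gaussianReal 0 (1/2)))

/-- The spectral norm (largest singular value) of a complex matrix, i.e. the
operator norm of the induced map between Euclidean spaces. -/
noncomputable def specNorm {m n : Type*} [Fintype m] [Fintype n] [DecidableEq n]
    (A : Matrix m n ℂ) : ℝ :=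
  ‖LinearMap.toContinuousLinearMap (Matrix.toEuclideanLin A)‖

section DeterministicEquivalent

open scoped Matrix.Norms.L2Operator ENNReal NNReal ComplexOrder

section Resolvent

variable {m n : Type*} [Fintype m] [Fintype n] [DecidableEq n]

/-- The regularized Gram matrix `Xᴴ X / N + α I`. -/
noncomputable def regGram (N : ℕ) (α : ℝ) (X : m → n → ℂ) : Matrix n n ℂ :=
  (N : ℂ)⁻¹ • ((of X)ᴴ * of X) + (α : ℂ) • 1

/-- The resolvent `(Xᴴ X / N + α I)⁻¹`. -/
noncomputable def regResolvent (N : ℕ) (α : ℝ) (X : m → n → ℂ) : Matrix n n ℂ :=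
  (regGram N α X)⁻¹

theorem posDef_regGram (N : ℕ) {α : ℝ} (hα : 0 < α) (X : m → n → ℂ) :
    (regGram N α X).PosDef := by
  refine PosDef.posSemidef_add ?_ ?_
  · refine (posSemidef_conjTranspose_mul_self (of X)).smul ?_
    rw [← Complex.ofReal_natCast, ← Complex.ofReal_inv]
    exact_mod_cast inv_nonneg.2 (Nat.cast_nonneg N)
  · exact PosDef.one.smul (by exact_mod_cast hα)

theorem regGram_mul_resolvent (N : ℕ) {α : ℝ} (hα : 0 < α) (X : m → n → ℂ) :
    regGram N α X * regResolvent N α X = 1 :=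
  mul_nonsing_inv _ ((isUnit_iff_isUnit_det _).1 (posDef_regGram N hα X).isUnit)

theorem resolvent_mul_regGram (N : ℕ) {α : ℝ} (hα : 0 < α) (X : m → n → ℂ) :
    regResolvent N α X * regGram N α X = 1 :=
  nonsing_inv_mul _ ((isUnit_iff_isUnit_det _).1 (posDef_regGram N hα X).isUnit)

theorem isHermitian_resolvent (N : ℕ) {α : ℝ} (hα : 0 < α) (X : m → n → ℂ) :
    (regResolvent N α X).IsHermitian :=
  (posDef_regGram N hα X).isHermitian.inv

theorem regGram_update {m n : Type*} [Fintype m] [DecidableEq m] [DecidableEq n] (N : ℕ) (α : ℝ)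
    (X : m → n → ℂ) (k : m) (r : n → ℂ) :
    regGram N α (Function.update X k r) =
      regGram N α (Function.update X k 0) + (N : ℂ)⁻¹ • vecMulVec (star r) r := by
  ext i j
  simp only [regGram, Matrix.add_apply, Matrix.smul_apply, Matrix.mul_apply, conjTranspose_apply,
    of_apply, vecMulVec_apply, smul_eq_mul, Pi.star_apply]
  rw [← Finset.add_sum_erase _ _ (Finset.mem_univ k),
    ← Finset.add_sum_erase _ (fun p => star (Function.update X k 0 p i) * _) (Finset.mem_univ k)]
  have h : ∀ s : n → ℂ, ∑ x ∈ Finset.univ.erase k,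
      star (Function.update X k s x i) * Function.update X k s x j =
      ∑ x ∈ Finset.univ.erase k, star (X x i) * X x j := fun s =>
    Finset.sum_congr rfl fun x hx => by
      rw [Function.update_of_ne (Finset.ne_of_mem_erase hx)]
  rw [h, h]
  simp only [Function.update_self, Pi.zero_apply, star_zero, mul_zero, zero_add]
  ring

theorem norm_star_dotProduct_le {n : Type*} [Fintype n] (v w : n → ℂ) :
    ‖star v ⬝ᵥ w‖ ≤ ‖WithLp.toLp 2 v‖ * ‖WithLp.toLp 2 w‖ := by
  have := norm_inner_le_norm (𝕜 := ℂ) (WithLp.toLp 2 v) (WithLp.toLp 2 w)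
  rwa [EuclideanSpace.inner_eq_star_dotProduct, dotProduct_comm] at this

theorem star_dotProduct_self_eq {n : Type*} [Fintype n] (v : n → ℂ) :
    star v ⬝ᵥ v = ((‖WithLp.toLp 2 v‖ ^ 2 : ℝ) : ℂ) := by
  have := inner_self_eq_norm_sq_to_K (𝕜 := ℂ) (WithLp.toLp 2 v)
  rw [EuclideanSpace.inner_eq_star_dotProduct, dotProduct_comm] at this
  simpa using this

theorem coercive_regGram (N : ℕ) {α : ℝ} (X : m → n → ℂ) (v : n → ℂ) :
    α * ‖WithLp.toLp 2 v‖ ^ 2 ≤ (star v ⬝ᵥ regGram N α X *ᵥ v).re := by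
  have h1 : (0 : ℂ) ≤ star v ⬝ᵥ ((N : ℂ)⁻¹ • ((of X)ᴴ * of X)) *ᵥ v := by
    refine PosSemidef.dotProduct_mulVec_nonneg ?_ v
    refine (posSemidef_conjTranspose_mul_self (of X)).smul ?_
    rw [← Complex.ofReal_natCast, ← Complex.ofReal_inv]
    exact_mod_cast inv_nonneg.2 (Nat.cast_nonneg N)
  have h2 := (Complex.le_def.1 h1).1
  rw [regGram, add_mulVec, dotProduct_add, Complex.add_re, smul_mulVec (α : ℂ), one_mulVec,
    dotProduct_smul, star_dotProduct_self_eq, smul_eq_mul, ← Complex.ofReal_mul, Complex.ofReal_re]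
  simpa using h2

theorem norm_resolvent_mulVec_sq_le (N : ℕ) {α : ℝ} (hα : 0 < α) (X : m → n → ℂ) (w : n → ℂ) :
    α * ‖WithLp.toLp 2 (regResolvent N α X *ᵥ w)‖ ^ 2 ≤ (star w ⬝ᵥ regResolvent N α X *ᵥ w).re := by
  refine (coercive_regGram N X _).trans_eq ?_
  rw [mulVec_mulVec, regGram_mul_resolvent N hα, one_mulVec, ← Complex.conj_re]
  congr 1
  rw [star_dotProduct, ← starRingEnd_apply, Complex.conj_conj]

theorem norm_resolvent_le (N : ℕ) {α : ℝ} (hα : 0 < α) (X : m → n → ℂ) :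
    ‖regResolvent N α X‖ ≤ α⁻¹ := by
  rw [l2_opNorm_def]
  refine ContinuousLinearMap.opNorm_le_bound _ (inv_nonneg.2 hα.le) fun x => ?_
  obtain ⟨w, rfl⟩ : ∃ w, x = WithLp.toLp 2 w := ⟨x.ofLp, rfl⟩
  have h1 := norm_resolvent_mulVec_sq_le N hα X w
  have h2 := (Complex.re_le_norm _).trans (norm_star_dotProduct_le w (regResolvent N α X *ᵥ w))
  change ‖WithLp.toLp 2 (regResolvent N α X *ᵥ w)‖ ≤ _
  rw [← div_eq_inv_mul, le_div_iff₀ hα]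
  by_contra! hcon
  have h3 : 0 < ‖WithLp.toLp 2 (regResolvent N α X *ᵥ w)‖ := by
    by_contra! h0
    nlinarith [norm_nonneg (WithLp.toLp 2 w), norm_nonneg (WithLp.toLp 2 (regResolvent N α X *ᵥ w))]
  nlinarith

/-- The normalized quadratic form `r A rᴴ / N` of a row `r`. -/
noncomputable def rowForm (N : ℕ) (A : Matrix n n ℂ) (r : n → ℂ) : ℂ :=
  (N : ℂ)⁻¹ * (r ⬝ᵥ A *ᵥ star r)

theorem re_rowForm_nonneg (N : ℕ) {α : ℝ} (hα : 0 < α) (X : m → n → ℂ) (r : n → ℂ) :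
    0 ≤ (rowForm N (regResolvent N α X) r).re := by
  have h := norm_resolvent_mulVec_sq_le N hα X (star r)
  rw [star_star] at h
  rw [rowForm, ← Complex.ofReal_natCast, ← Complex.ofReal_inv, Complex.re_ofReal_mul]
  exact mul_nonneg (by positivity) ((by positivity : (0 : ℝ) ≤ _).trans h)

theorem one_le_norm_one_add {z : ℂ} (hz : 0 ≤ z.re) : 1 ≤ ‖1 + z‖ :=
  le_trans (by simp [hz]) (Complex.re_le_norm (1 + z))

theorem one_add_ne_zero_of_re_nonneg {z : ℂ} (hz : 0 ≤ z.re) : 1 + z ≠ 0 :=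
  norm_pos_iff.1 (zero_lt_one.trans_le (one_le_norm_one_add hz))

/-- Sherman–Morrison: the resolvent applied to one of its rows. -/
theorem resolvent_update_mulVec [DecidableEq m] (N : ℕ) {α : ℝ} (hα : 0 < α) (X : m → n → ℂ) (k : m)
    (r : n → ℂ) :
    (1 + rowForm N (regResolvent N α (Function.update X k 0)) r) •
      (regResolvent N α (Function.update X k r) *ᵥ star r) =
      regResolvent N α (Function.update X k 0) *ᵥ star r := by
  set Q₀ := regResolvent N α (Function.update X k 0)
  set Q := regResolvent N α (Function.update X k r)
  have h : regGram N α (Function.update X k r) *ᵥ (Q₀ *ᵥ star r) =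
      (1 + rowForm N Q₀ r) • star r := by
    rw [regGram_update, add_mulVec, mulVec_mulVec, regGram_mul_resolvent N hα, one_mulVec,
      smul_mulVec, vecMulVec_mulVec, add_smul, one_smul, rowForm]
    simp [smul_smul]
  rw [← mulVec_smul, ← h, mulVec_mulVec, resolvent_mul_regGram N hα, one_mulVec]

/-- The trace against `U` is Lipschitz under deletion of a row. -/
theorem norm_trace_resolvent_update_sub_le [DecidableEq m] (N : ℕ) (hN : N ≠ 0) {α : ℝ}
    (hα : 0 < α) (X : m → n → ℂ) (k : m) (r : n → ℂ) (U : Matrix n n ℂ) :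
    ‖trace (U * regResolvent N α (Function.update X k r)) -
      trace (U * regResolvent N α (Function.update X k 0))‖ ≤ ‖U‖ / α := by
  have hSM := resolvent_update_mulVec N hα X k r
  have hre := re_rowForm_nonneg N hα (Function.update X k 0) r
  have hsq := norm_resolvent_mulVec_sq_le N hα (Function.update X k 0) (star r)
  have hherm := isHermitian_resolvent N hα (Function.update X k 0)
  have hG : regResolvent N α (Function.update X k r) - regResolvent N α (Function.update X k 0) =
      - ((N : ℂ)⁻¹ • (regResolvent N α (Function.update X k r) * vecMulVec (star r) r *
        regResolvent N α (Function.update X k 0))) := by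
    have h1 : regResolvent N α (Function.update X k r) - regResolvent N α (Function.update X k 0) =
        regResolvent N α (Function.update X k r) * (regGram N α (Function.update X k 0) -
          regGram N α (Function.update X k r)) * regResolvent N α (Function.update X k 0) := by
      rw [mul_sub, sub_mul, resolvent_mul_regGram N hα, one_mul, mul_assoc,
        regGram_mul_resolvent N hα, mul_one]
    rw [h1, regGram_update N α X k r]
    simp
  set Q₀ := regResolvent N α (Function.update X k 0)
  set Q := regResolvent N α (Function.update X k r)
  have hN' : (0 : ℝ) < N := by positivity
  have key : (1 + rowForm N Q₀ r) * (trace (U * Q) - trace (U * Q₀)) =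
      - ((N : ℂ)⁻¹ * (star (Q₀ *ᵥ star r) ⬝ᵥ U *ᵥ (Q₀ *ᵥ star r))) := by
    rw [← trace_sub, ← mul_sub, hG, mul_neg, trace_neg, mul_neg, mul_smul_comm, trace_smul,
      smul_eq_mul, mul_left_comm, mul_vecMulVec, vecMulVec_mul, mul_vecMulVec, trace_vecMulVec,
      star_mulVec, star_star, hherm.eq, ← hSM]
    simp only [mulVec_smul, dotProduct_smul, smul_eq_mul]
    rw [dotProduct_comm]
  have hb : ‖star (Q₀ *ᵥ star r) ⬝ᵥ U *ᵥ (Q₀ *ᵥ star r)‖ ≤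
      ‖U‖ * ‖WithLp.toLp 2 (Q₀ *ᵥ star r)‖ ^ 2 := by
    refine (norm_star_dotProduct_le _ _).trans ?_
    have := l2_opNorm_mulVec U (WithLp.toLp 2 (Q₀ *ᵥ star r))
    have h' : ‖WithLp.toLp 2 (U *ᵥ (Q₀ *ᵥ star r))‖ ≤ ‖U‖ * ‖WithLp.toLp 2 (Q₀ *ᵥ star r)‖ := this
    nlinarith [norm_nonneg (WithLp.toLp 2 (Q₀ *ᵥ star r))]
  have hre' : (rowForm N Q₀ r).re = (N : ℝ)⁻¹ * (star (star r) ⬝ᵥ Q₀ *ᵥ star r).re := by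
    rw [rowForm, ← Complex.ofReal_natCast, ← Complex.ofReal_inv, Complex.re_ofReal_mul, star_star]
  have hnorm : (rowForm N Q₀ r).re ≤ ‖1 + rowForm N Q₀ r‖ :=
    le_trans (by simp) (Complex.re_le_norm (1 + rowForm N Q₀ r))
  have h1 := one_le_norm_one_add hre
  have hk := congrArg norm key
  rw [norm_mul, norm_neg, norm_mul, norm_inv, Complex.norm_natCast] at hk
  rw [le_div_iff₀ hα]
  have h2 : ‖1 + rowForm N Q₀ r‖ * (‖trace (U * Q) - trace (U * Q₀)‖ * α) ≤
      ‖1 + rowForm N Q₀ r‖ * ‖U‖ := by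
    calc _ = (N : ℝ)⁻¹ * ‖star (Q₀ *ᵥ star r) ⬝ᵥ U *ᵥ (Q₀ *ᵥ star r)‖ * α := by rw [← hk]; ring
      _ ≤ (N : ℝ)⁻¹ * (‖U‖ * ‖WithLp.toLp 2 (Q₀ *ᵥ star r)‖ ^ 2) * α := by gcongr
      _ = ‖U‖ * ((N : ℝ)⁻¹ * (α * ‖WithLp.toLp 2 (Q₀ *ᵥ star r)‖ ^ 2)) := by ring
      _ ≤ ‖U‖ * ((N : ℝ)⁻¹ * (star (star r) ⬝ᵥ Q₀ *ᵥ star r).re) := by gcongr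
      _ ≤ ‖U‖ * ‖1 + rowForm N Q₀ r‖ := by rw [← hre']; gcongr
      _ = _ := mul_comm _ _
  exact le_of_mul_le_mul_left h2 (zero_lt_one.trans_le h1)

theorem trace_eq_add_sum_rowForm [DecidableEq m] (N : ℕ) {α : ℝ} (hα : 0 < α) (X : m → n → ℂ)
    (U : Matrix n n ℂ) :
    trace U = α * trace (U * regResolvent N α X) +
      ∑ k, rowForm N (U * regResolvent N α (Function.update X k 0)) (X k) /
        (1 + rowForm N (regResolvent N α (Function.update X k 0)) (X k)) := by
  have h : ∀ k, rowForm N (U * regResolvent N α (Function.update X k 0)) (X k) /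
        (1 + rowForm N (regResolvent N α (Function.update X k 0)) (X k)) =
        rowForm N (U * regResolvent N α X) (X k) := fun k => by
    have hSM := resolvent_update_mulVec N hα X k (X k)
    rw [Function.update_eq_self] at hSM
    rw [div_eq_iff (one_add_ne_zero_of_re_nonneg (re_rowForm_nonneg N hα _ _))]
    generalize 1 + rowForm N (regResolvent N α (Function.update X k 0)) (X k) = c at hSM ⊢
    rw [rowForm, rowForm, ← mulVec_mulVec, ← hSM, ← mulVec_mulVec, mulVec_smul, dotProduct_smul,
      smul_eq_mul]
    ring
  have h2 : trace U = trace (U * regResolvent N α X * regGram N α X) := by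
    rw [mul_assoc, resolvent_mul_regGram N hα, mul_one]
  rw [Finset.sum_congr rfl fun k _ => h k, h2]
  have h3 : regGram N α X = (N : ℂ)⁻¹ • ((of X)ᴴ * of X) + (α : ℂ) • 1 := rfl
  rw [h3, mul_add, trace_add, mul_smul_comm, mul_smul_comm, mul_one, trace_smul, trace_smul,
    add_comm]
  congr 1
  rw [← Matrix.mul_assoc, trace_mul_comm]
  simp only [rowForm, ← Finset.mul_sum, smul_eq_mul]
  congr 1

theorem norm_trace_le (A : Matrix n n ℂ) : ‖trace A‖ ≤ Fintype.card n * ‖A‖ := by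
  refine (norm_sum_le _ _).trans ((Finset.sum_le_card_nsmul _ _ ‖A‖ fun i _ => ?_).trans_eq
    (by simp))
  have := l2_opNorm_mulVec A (EuclideanSpace.single i (1 : ℂ))
  refine le_trans ?_ (this.trans_eq (by simp))
  have h := PiLp.norm_apply_le (WithLp.toLp 2 (A *ᵥ (EuclideanSpace.single i (1 : ℂ)).ofLp)) i
  simpa using h

theorem sum_norm_sq_le (A : Matrix n n ℂ) :
    ∑ i, ∑ j, ‖A i j‖ ^ 2 ≤ Fintype.card n * ‖A‖ ^ 2 := by
  rw [Finset.sum_comm]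
  refine (Finset.sum_le_card_nsmul _ _ (‖A‖ ^ 2) fun j _ => ?_).trans_eq (by simp)
  have h := l2_opNorm_mulVec A (EuclideanSpace.single j (1 : ℂ))
  have h2 : ‖WithLp.toLp 2 (A *ᵥ (EuclideanSpace.single j (1 : ℂ)).ofLp)‖ ^ 2 =
    ∑ i, ‖A i j‖ ^ 2 := by rw [EuclideanSpace.norm_sq_eq]; simp
  rw [← h2]
  gcongr
  simpa using h

end Resolvent

section BoundedDifferences

variable {E : Type*} [MeasurableSpace E]

theorem measurable_finCons {n : ℕ} :
    Measurable fun p : E × (Fin n → E) => (Fin.cons p.1 p.2 : Fin (n + 1) → E) :=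
  measurable_pi_iff.2 fun i => by
    refine Fin.cases ?_ (fun j => ?_) i
    · exact measurable_fst
    · exact (measurable_pi_apply j).comp measurable_snd

theorem measurePreserving_finCons (ν : Measure E) [IsProbabilityMeasure ν] (n : ℕ) :
    MeasurePreserving (fun p : E × (Fin n → E) => (Fin.cons p.1 p.2 : Fin (n + 1) → E))
      (ν.prod (Measure.pi fun _ => ν)) (Measure.pi fun _ => ν) := by
  convert (measurePreserving_piFinSuccAbove (fun _ : Fin (n + 1) => ν) 0).symm using 1
  ext p i
  refine Fin.cases ?_ (fun j => ?_) i <;> simp [MeasurableEquiv.piFinSuccAbove]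

theorem integral_pi_succ (ν : Measure E) [IsProbabilityMeasure ν] {n : ℕ}
    (f : (Fin (n + 1) → E) → ℝ) (hf : Measurable f) {B : ℝ} (hB : ∀ x, |f x| ≤ B) :
    ∫ x, f x ∂(Measure.pi fun _ => ν) =
      ∫ y, ∫ z, f (Fin.cons z y) ∂ν ∂(Measure.pi fun _ : Fin n => ν) := by
  have he := measurePreserving_finCons ν n
  rw [← he.map_eq, integral_map he.measurable.aemeasurable hf.aestronglyMeasurable]
  exact integral_prod_symm (fun p => f (Fin.cons p.1 p.2)) (Integrable.of_bound
    (hf.comp he.measurable).aestronglyMeasurable B (.of_forall fun p => hB _))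

theorem lintegral_pi_succ (ν : Measure E) [IsProbabilityMeasure ν]
    {n : ℕ} (f : (Fin (n + 1) → E) → ℝ≥0∞) (hf : Measurable f) :
    ∫⁻ x, f x ∂(Measure.pi fun _ => ν) =
      ∫⁻ y, ∫⁻ z, f (Fin.cons z y) ∂ν ∂(Measure.pi fun _ : Fin n => ν) := by
  have he := measurePreserving_finCons ν n
  rw [← he.lintegral_comp hf]
  exact lintegral_prod_symm' (fun p => f (Fin.cons p.1 p.2)) (hf.comp he.measurable)

/-- McDiarmid's inequality, in exponential moment form. -/
theorem integral_exp_le_of_bounded_differences (ν : Measure E) [IsProbabilityMeasure ν] {c : ℝ}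
    (hc : 0 ≤ c) (t : ℝ) {n : ℕ} (f : (Fin n → E) → ℝ) (hf : Measurable f) {B : ℝ}
    (hB : ∀ x, |f x| ≤ B) (hd : ∀ x k r, |f (Function.update x k r) - f x| ≤ c) :
    ∫ x, Real.exp (t * (f x - ∫ y, f y ∂(Measure.pi fun _ => ν))) ∂(Measure.pi fun _ => ν) ≤
      Real.exp (n * c ^ 2 * t ^ 2 / 2) := by
  induction n with
  | zero =>
    have h : ∀ x, f x = f default := fun x => congrArg f (Subsingleton.elim _ _)
    simp [h]
  | succ n ih =>
    set π := Measure.pi fun _ : Fin n => ν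
    set g : (Fin n → E) → ℝ := fun y => ∫ z, f (Fin.cons z y) ∂ν with hg
    have hfm : Measurable fun p : E × (Fin n → E) => f (Fin.cons p.1 p.2) :=
      hf.comp measurable_finCons
    have hfy : ∀ y, Measurable fun z => f (Fin.cons z y) := fun y =>
      hfm.comp (measurable_id.prodMk measurable_const)
    have h_int : ∀ y, Integrable (fun z => f (Fin.cons z y)) ν := fun y =>
      Integrable.of_bound (hfy y).aestronglyMeasurable B (.of_forall fun z => hB _)
    have hgm : Measurable g :=
      (hfm.stronglyMeasurable.integral_prod_left' (μ := ν)).measurable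
    have hgB : ∀ y, |g y| ≤ B := fun y => by
      have := norm_integral_le_of_norm_le_const (μ := ν) (f := fun z => f (Fin.cons z y))
        (.of_forall fun z => hB _)
      simpa using this
    have hgd : ∀ y k r, |g (Function.update y k r) - g y| ≤ c := fun y k r => by
      rw [hg]
      simp only
      rw [← integral_sub (h_int _) (h_int _)]
      have := norm_integral_le_of_norm_le_const (μ := ν)
        (f := fun z => f (Fin.cons z (Function.update y k r)) - f (Fin.cons z y)) (C := c)
        (.of_forall fun z => by
          rw [Fin.cons_update]
          exact hd _ _ _)
      simpa using this
    have hmean : ∫ x, f x ∂(Measure.pi fun _ => ν) = ∫ y, g y ∂π := integral_pi_succ ν f hf hB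
    set m := ∫ y, g y ∂π
    have hBm : |m| ≤ B := by
      have := norm_integral_le_of_norm_le_const (μ := π) (f := g) (.of_forall hgB)
      simpa using this
    have hexpB : ∀ {u : ℝ}, |u| ≤ B → |Real.exp (t * (u - m))| ≤ Real.exp (|t| * (B + B)) :=
      fun {u} hu => by
        rw [Real.abs_exp, Real.exp_le_exp]
        calc t * (u - m) ≤ |t * (u - m)| := le_abs_self _
          _ = |t| * |u - m| := abs_mul _ _
          _ ≤ |t| * (B + B) := by
            gcongr
            exact (abs_sub _ _).trans (add_le_add hu hBm)
    rw [hmean, integral_pi_succ ν _ (by fun_prop) fun x => hexpB (hB x)]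
    have hinner : ∀ y, ∫ z, Real.exp (t * (f (Fin.cons z y) - m)) ∂ν ≤
        Real.exp (t * (g y - m)) * Real.exp (c ^ 2 * t ^ 2 / 2) := fun y => by
      have hE : Nonempty E := by
        by_contra h
        rw [not_nonempty_iff] at h
        exact IsProbabilityMeasure.ne_zero ν (Measure.eq_zero_of_isEmpty ν)
      obtain ⟨z₀⟩ := hE
      have hsub := hasSubgaussianMGF_of_mem_Icc (μ := ν) (X := fun z => f (Fin.cons z y))
        (a := f (Fin.cons z₀ y) - c) (b := f (Fin.cons z₀ y) + c) (hfy y).aemeasurable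
        (.of_forall fun z => by
          have := abs_le.1 (hd (Fin.cons z₀ y) 0 z)
          rw [Fin.update_cons_zero] at this
          constructor <;> linarith)
      have h1 := hsub.mgf_le t
      simp only [mgf] at h1
      have h2 : ((‖f (Fin.cons z₀ y) + c - (f (Fin.cons z₀ y) - c)‖₊ / 2 : ℝ≥0) : ℝ) = c := by
        rw [NNReal.coe_div, coe_nnnorm]
        rw [show f (Fin.cons z₀ y) + c - (f (Fin.cons z₀ y) - c) = 2 * c by ring, Real.norm_eq_abs,
          abs_of_nonneg (by positivity)]
        simp
      rw [NNReal.coe_pow, h2] at h1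
      calc ∫ z, Real.exp (t * (f (Fin.cons z y) - m)) ∂ν
          = ∫ z, Real.exp (t * (g y - m)) * Real.exp (t * (f (Fin.cons z y) - g y)) ∂ν := by
            congr 1 with z
            rw [← Real.exp_add]
            ring_nf
        _ = Real.exp (t * (g y - m)) * ∫ z, Real.exp (t * (f (Fin.cons z y) - g y)) ∂ν :=
            integral_const_mul _ _
        _ ≤ _ := by gcongr
    calc ∫ y, ∫ z, Real.exp (t * (f (Fin.cons z y) - m)) ∂ν ∂π
        ≤ ∫ y, Real.exp (t * (g y - m)) * Real.exp (c ^ 2 * t ^ 2 / 2) ∂π := by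
          refine integral_mono_of_nonneg (.of_forall fun y => integral_nonneg fun z =>
            (Real.exp_pos _).le) ?_ (.of_forall hinner)
          refine Integrable.mul_const (Integrable.of_bound (by fun_prop)
            (Real.exp (|t| * (B + B))) (.of_forall fun y => hexpB (hgB y))) _
      _ = (∫ y, Real.exp (t * (g y - m)) ∂π) * Real.exp (c ^ 2 * t ^ 2 / 2) :=
          integral_mul_const _ _
      _ ≤ Real.exp (n * c ^ 2 * t ^ 2 / 2) * Real.exp (c ^ 2 * t ^ 2 / 2) := by
          gcongr
          exact ih g hgm hgB hgd
      _ = _ := by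
          rw [← Real.exp_add]
          push_cast
          ring_nf

/-- McDiarmid's inequality. -/
theorem hasSubgaussianMGF_of_bounded_differences (ν : Measure E) [IsProbabilityMeasure ν]
    (c : ℝ≥0) {n : ℕ} (f : (Fin n → E) → ℝ) (hf : Measurable f) {B : ℝ}
    (hB : ∀ x, |f x| ≤ B) (hd : ∀ x k r, |f (Function.update x k r) - f x| ≤ c) :
    HasSubgaussianMGF (fun x => f x - ∫ y, f y ∂(Measure.pi fun _ => ν)) (n * c ^ 2)
      (Measure.pi fun _ => ν) where
  integrable_exp_mul t := by
    have h : ∀ x, |f x - ∫ y, f y ∂(Measure.pi fun _ => ν)| ≤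
        B + |∫ y, f y ∂(Measure.pi fun _ => ν)| := fun x =>
      (abs_sub _ _).trans (add_le_add_left (hB x) _)
    refine Integrable.of_bound (by fun_prop)
      (Real.exp (|t| * (B + |∫ y, f y ∂(Measure.pi fun _ => ν)|))) (.of_forall fun x => ?_)
    rw [Real.norm_eq_abs, Real.abs_exp, Real.exp_le_exp]
    refine (le_abs_self _).trans ?_
    rw [abs_mul]
    gcongr
    exact h x
  mgf_le t := by
    have := integral_exp_le_of_bounded_differences ν c.2 t f hf hB hd
    simpa [mgf] using this

theorem integral_abs_le_of_hasSubgaussianMGF {Ω : Type*} [MeasurableSpace Ω] {μ : Measure Ω}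
    {X : Ω → ℝ} {c : ℝ≥0} (h : HasSubgaussianMGF X c μ) {t : ℝ} (ht : 0 < t) :
    ∫ ω, |X ω| ∂μ ≤ 2 * Real.exp (c * t ^ 2 / 2) / t := by
  have h1 : ∀ ω, |X ω| ≤ (Real.exp (t * X ω) + Real.exp (-t * X ω)) / t := fun ω => by
    rw [le_div_iff₀ ht]
    rcases abs_cases (X ω) with ⟨h', _⟩ | ⟨h', _⟩ <;> rw [h'] <;>
      nlinarith [Real.add_one_le_exp (t * X ω), Real.add_one_le_exp (-t * X ω),
        Real.exp_pos (t * X ω), Real.exp_pos (-t * X ω)]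
  calc ∫ ω, |X ω| ∂μ ≤ ∫ ω, (Real.exp (t * X ω) + Real.exp (-t * X ω)) / t ∂μ :=
        integral_mono h.integrable.abs
          (((h.integrable_exp_mul t).add (h.integrable_exp_mul (-t))).div_const t) h1
    _ = (mgf X μ t + mgf X μ (-t)) / t := by
        rw [integral_div, integral_add (h.integrable_exp_mul t) (h.integrable_exp_mul (-t))]
        rfl
    _ ≤ (Real.exp (c * t ^ 2 / 2) + Real.exp (c * t ^ 2 / 2)) / t := by
        gcongr
        · exact h.mgf_le t
        · simpa using h.mgf_le (-t)
    _ = _ := by ring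

end BoundedDifferences

section GaussianMoments

instance : IsProbabilityMeasure stdCGaussian :=
  Measure.isProbabilityMeasure_map (by fun_prop)

theorem memLp_id_stdCGaussian : MemLp id 4 stdCGaussian := by
  rw [stdCGaussian, memLp_map_measure_iff (by fun_prop) (by fun_prop)]
  have h : MemLp (fun x : ℝ => (x : ℂ)) 4 (gaussianReal 0 (1/2)) :=
    (memLp_id_gaussianReal' 4 (by simp)).ofReal
  exact (h.comp_fst _).add ((h.comp_snd _).mul_const Complex.I)

theorem integral_id_stdCGaussian : ∫ z, z ∂stdCGaussian = 0 := by
  have h : Integrable (fun x : ℝ => (x : ℂ)) (gaussianReal 0 (1/2)) :=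
    ((memLp_id_gaussianReal' 1 (by simp)).ofReal (K := ℂ)).integrable le_rfl
  rw [stdCGaussian, integral_map (by fun_prop) (by fun_prop),
    integral_add (h.comp_fst _) ((h.comp_snd _).mul_const _), integral_mul_const]
  rw [integral_fun_fst (fun x : ℝ => (x : ℂ)), integral_fun_snd (fun x : ℝ => (x : ℂ))]
  have h0 : ∫ x, (x : ℂ) ∂gaussianReal 0 (1/2) = 0 := by
    rw [integral_complex_ofReal]
    simp
  rw [h0]
  simp

theorem integral_sq_gaussianReal_zero (v : ℝ≥0) : ∫ x, x ^ 2 ∂gaussianReal 0 v = v := by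
  have := variance_fun_id_gaussianReal (μ := 0) (v := v)
  rwa [variance_of_integral_eq_zero (by fun_prop) (by simp)] at this

theorem integral_norm_sq_stdCGaussian : ∫ z, ‖z‖ ^ 2 ∂stdCGaussian = 1 := by
  have h : Integrable (fun x : ℝ => x ^ 2) (gaussianReal 0 (1/2)) :=
    (memLp_id_gaussianReal' 2 (by simp)).integrable_sq
  rw [stdCGaussian, integral_map (by fun_prop) (by fun_prop)]
  have h2 : ∀ p : ℝ × ℝ, ‖(p.1 : ℂ) + p.2 * Complex.I‖ ^ 2 = p.1 ^ 2 + p.2 ^ 2 := fun p => by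
    rw [Complex.sq_norm, Complex.normSq_add_mul_I]
  simp only [h2]
  rw [integral_add (h.comp_fst _) (h.comp_snd _), integral_fun_fst (fun x : ℝ => x ^ 2),
    integral_fun_snd (fun x : ℝ => x ^ 2), integral_sq_gaussianReal_zero]
  norm_num

end GaussianMoments

section QuadraticForm

/-- Second moment of an affine-quadratic polynomial in one centred complex variable. -/
theorem exists_lintegral_quadratic_le (γ : Measure ℂ) [IsProbabilityMeasure γ]
    (h4 : MemLp id 4 γ) (h1 : ∫ z, z ∂γ = 0) (h2 : ∫ z, ‖z‖ ^ 2 ∂γ = 1) :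
    ∃ D : ℝ≥0, 1 ≤ D ∧ ∀ a b c d : ℂ,
      ∫⁻ z, ‖a * (z * star z - 1) + z * b + c * star z + d‖ₑ ^ 2 ∂γ ≤
        ‖d‖ₑ ^ 2 + D * (‖a‖ₑ ^ 2 + ‖b‖ₑ ^ 2 + ‖c‖ₑ ^ 2) := by
  have hz : MemLp (fun z : ℂ => z) 2 γ := h4.mono_exponent (by norm_num)
  have hzs : MemLp (fun z : ℂ => star z) 2 γ := hz.star
  have hzi : Integrable (fun z : ℂ => z) γ := hz.integrable (by norm_num)
  have hzsi : Integrable (fun z : ℂ => star z) γ := hzs.integrable (by norm_num)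
  have hw : MemLp (fun z : ℂ => z * star z) 2 γ := by
    have : ENNReal.HolderTriple 4 4 2 := ⟨by
      rw [← two_mul, show (4 : ℝ≥0∞) = 2 * 2 by norm_num,
        ENNReal.mul_inv (by simp) (by simp), ← mul_assoc,
        ENNReal.mul_inv_cancel (by simp) (by simp),
        one_mul]⟩
    exact MemLp.mul (r := 2) (p := 4) (q := 4) h4.star h4
  have hw1 : MemLp (fun z : ℂ => z * star z - 1) 2 γ := hw.sub (memLp_const 1)
  have hzsq : Integrable (fun z : ℂ => ‖z‖ ^ 2) γ := hz.norm.integrable_sq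
  have hw1sq : Integrable (fun z : ℂ => ‖z * star z - 1‖ ^ 2) γ := hw1.norm.integrable_sq
  have hstar : ∫ z, star z ∂γ = 0 := by
    have := integral_conj (μ := γ) (f := fun z : ℂ => z)
    rw [h1, map_zero] at this
    exact this
  have hmean : ∫ z, (z * star z - 1) ∂γ = 0 := by
    rw [integral_sub (hw.integrable (by norm_num)) (integrable_const _)]
    have : ∀ z : ℂ, z * star z = ((‖z‖ ^ 2 : ℝ) : ℂ) := fun z => by
      rw [← starRingEnd_apply, Complex.mul_conj, Complex.normSq_eq_norm_sq]
    simp only [this]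
    rw [integral_complex_ofReal, h2]
    simp
  set κ := ∫ z, ‖z * star z - 1‖ ^ 2 ∂γ
  have hκ : 0 ≤ κ := integral_nonneg fun z => by positivity
  refine ⟨(3 * (κ + 1)).toNNReal, ?_, fun a b c d => ?_⟩
  · rw [Real.one_le_toNNReal]
    linarith
  set R : ℂ → ℂ := fun z => a * (z * star z - 1) + z * b + c * star z with hR
  have hRL : MemLp R 2 γ := ((hw1.const_mul a).add (hz.mul_const b)).add (hzs.const_mul c)
  have hRi : Integrable R γ := hRL.integrable (by norm_num)
  have hR0 : ∫ z, R z ∂γ = 0 := by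
    have hi := (hw1.integrable (by norm_num)).const_mul a
    have hi' : Integrable (fun z => a * (z * star z - 1) + z * b) γ := hi.add (hzi.mul_const b)
    simp only [hR]
    rw [integral_add hi' (hzsi.const_mul c), integral_add hi (hzi.mul_const b), integral_const_mul,
      integral_const_mul, integral_mul_const, hmean, h1,
      hstar]
    simp
  have hRsq : Integrable (fun z => ‖R z‖ ^ 2) γ := hRL.norm.integrable_sq
  have hP : MemLp (fun z => R z + d) 2 γ := hRL.add (memLp_const d)
  have hPsq : Integrable (fun z => ‖R z + d‖ ^ 2) γ := hP.norm.integrable_sq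
  have hRle : ∫ z, ‖R z‖ ^ 2 ∂γ ≤ 3 * (κ + 1) * (‖a‖ ^ 2 + ‖b‖ ^ 2 + ‖c‖ ^ 2) := by
    calc ∫ z, ‖R z‖ ^ 2 ∂γ
        ≤ ∫ z, 3 * (‖a‖ ^ 2 * ‖z * star z - 1‖ ^ 2 + (‖b‖ ^ 2 + ‖c‖ ^ 2) * ‖z‖ ^ 2) ∂γ := by
          refine integral_mono hRsq
            (((hw1sq.const_mul _).add (hzsq.const_mul _)).const_mul 3) fun z => ?_
          have h : ‖R z‖ ≤ ‖a‖ * ‖z * star z - 1‖ + ‖z‖ * ‖b‖ + ‖c‖ * ‖z‖ := by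
            refine (norm_add₃_le).trans ?_
            simp only [norm_mul, norm_star, le_refl]
          have h' : ‖R z‖ ^ 2 ≤ (‖a‖ * ‖z * star z - 1‖ + ‖z‖ * ‖b‖ + ‖c‖ * ‖z‖) ^ 2 := by gcongr
          refine h'.trans ?_
          nlinarith [sq_nonneg (‖a‖ * ‖z * star z - 1‖ - ‖z‖ * ‖b‖),
            sq_nonneg (‖a‖ * ‖z * star z - 1‖ - ‖c‖ * ‖z‖), sq_nonneg (‖z‖ * ‖b‖ - ‖c‖ * ‖z‖)]
      _ = 3 * (‖a‖ ^ 2 * κ + (‖b‖ ^ 2 + ‖c‖ ^ 2)) := by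
          rw [integral_const_mul, integral_add (hw1sq.const_mul _) (hzsq.const_mul _),
            integral_const_mul, integral_const_mul, h2, mul_one]
      _ ≤ _ := by nlinarith [sq_nonneg ‖a‖, sq_nonneg ‖b‖, sq_nonneg ‖c‖]
  have hPle : ∫ z, ‖R z + d‖ ^ 2 ∂γ ≤
      ‖d‖ ^ 2 + 3 * (κ + 1) * (‖a‖ ^ 2 + ‖b‖ ^ 2 + ‖c‖ ^ 2) := by
    have hexp : ∀ z, ‖R z + d‖ ^ 2 = ‖R z‖ ^ 2 + (2 * (R z * star d).re + ‖d‖ ^ 2) := fun z => by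
      simp only [Complex.sq_norm, Complex.normSq_add, ← starRingEnd_apply]
      ring
    have hcross : Integrable (fun z => (R z * star d).re) γ := (hRi.mul_const _).re
    have hcross0 : ∫ z, (R z * star d).re ∂γ = 0 := by
      have := integral_re (hRi.mul_const (star d))
      rw [integral_mul_const, hR0] at this
      simpa using this
    simp only [hexp]
    have hi : Integrable (fun z => 2 * (R z * star d).re + ‖d‖ ^ 2) γ :=
      (hcross.const_mul 2).add (integrable_const _)
    rw [integral_add hRsq hi,
      integral_add (hcross.const_mul 2) (integrable_const _), integral_const_mul, hcross0]
    simp only [mul_zero, integral_const, probReal_univ, one_smul, zero_add]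
    linarith
  have hconv : ∀ w : ℂ, ‖w‖ₑ ^ 2 = ENNReal.ofReal (‖w‖ ^ 2) := fun w => by
    rw [ENNReal.ofReal_pow (norm_nonneg _), ofReal_norm]
  change _ ≤ _ + ENNReal.ofReal (3 * (κ + 1)) * _
  simp only [hconv]
  rw [← ENNReal.ofReal_add (by positivity) (by positivity),
    ← ENNReal.ofReal_add (by positivity) (by positivity), ← ENNReal.ofReal_mul (by positivity),
    ← ENNReal.ofReal_add (by positivity) (by positivity),
    ← ofReal_integral_eq_lintegral_ofReal hPsq (.of_forall fun z => by positivity)]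
  exact ENNReal.ofReal_le_ofReal hPle

theorem lintegral_linear_le {γ : Measure ℂ} [IsProbabilityMeasure γ] {D : ℝ≥0}
    (hD : ∀ a b c d : ℂ,
      ∫⁻ z, ‖a * (z * star z - 1) + z * b + c * star z + d‖ₑ ^ 2 ∂γ ≤
        ‖d‖ₑ ^ 2 + D * (‖a‖ₑ ^ 2 + ‖b‖ₑ ^ 2 + ‖c‖ₑ ^ 2)) {n : ℕ} (b : Fin n → ℂ) :
    ∫⁻ r, ‖∑ i, r i * b i‖ₑ ^ 2 ∂(Measure.pi fun _ => γ) ≤ D * ∑ i, ‖b i‖ₑ ^ 2 := by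
  induction n with
  | zero => simp
  | succ n ih =>
    rw [lintegral_pi_succ γ _ (by fun_prop)]
    calc _ ≤ ∫⁻ y, (‖∑ i, y i * b (Fin.succ i)‖ₑ ^ 2 + D * ‖b 0‖ₑ ^ 2)
          ∂(Measure.pi fun _ : Fin n => γ) := by
          refine lintegral_mono fun y => ?_
          have := hD 0 (b 0) 0 (∑ i, y i * b (Fin.succ i))
          simpa [Fin.sum_univ_succ] using this
      _ = ∫⁻ y, ‖∑ i, y i * b (Fin.succ i)‖ₑ ^ 2 ∂(Measure.pi fun _ : Fin n => γ) +
          D * ‖b 0‖ₑ ^ 2 := by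
          rw [lintegral_add_right _ measurable_const]
          simp
      _ ≤ D * ∑ i, ‖b (Fin.succ i)‖ₑ ^ 2 + D * ‖b 0‖ₑ ^ 2 := by
          gcongr
          exact ih _
      _ = _ := by rw [Fin.sum_univ_succ, mul_add, add_comm]

/-- Variance bound for quadratic forms in i.i.d. variables. -/
theorem lintegral_quadForm_sub_trace_le {γ : Measure ℂ} [IsProbabilityMeasure γ] {D : ℝ≥0}
    (hD1 : 1 ≤ D) (hD : ∀ a b c d : ℂ,
      ∫⁻ z, ‖a * (z * star z - 1) + z * b + c * star z + d‖ₑ ^ 2 ∂γ ≤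
        ‖d‖ₑ ^ 2 + D * (‖a‖ₑ ^ 2 + ‖b‖ₑ ^ 2 + ‖c‖ₑ ^ 2)) {n : ℕ}
    (A : Matrix (Fin n) (Fin n) ℂ) :
    ∫⁻ r, ‖r ⬝ᵥ A *ᵥ star r - trace A‖ₑ ^ 2 ∂(Measure.pi fun _ => γ) ≤
      D ^ 2 * ∑ i, ∑ j, ‖A i j‖ₑ ^ 2 := by
  have hform : ∀ {n : ℕ} (A : Matrix (Fin n) (Fin n) ℂ) (r : Fin n → ℂ),
      r ⬝ᵥ A *ᵥ star r - trace A = ∑ i, r i * ∑ j, A i j * star (r j) - ∑ i, A i i :=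
    fun A r => rfl
  simp only [hform]
  induction n with
  | zero => simp
  | succ n ih =>
    rw [lintegral_pi_succ γ _ (by fun_prop)]
    set A' : Matrix (Fin n) (Fin n) ℂ := A.submatrix Fin.succ Fin.succ
    set π := Measure.pi fun _ : Fin n => γ
    have hb : ∫⁻ y, ‖∑ j, A 0 (Fin.succ j) * star (y j)‖ₑ ^ 2 ∂π ≤
        D * ∑ j, ‖A 0 (Fin.succ j)‖ₑ ^ 2 := by
      have h := lintegral_linear_le hD fun j => star (A 0 (Fin.succ j))
      have h3 : ∀ w : ℂ, ‖star w‖ₑ = ‖w‖ₑ := fun w => by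
        rw [← ofReal_norm, norm_star, ofReal_norm]
      have h2 : ∀ y : Fin n → ℂ, ‖∑ j, A 0 (Fin.succ j) * star (y j)‖ₑ =
          ‖∑ j, y j * star (A 0 (Fin.succ j))‖ₑ := fun y => by
        rw [← h3, star_sum]
        simp only [star_mul, star_star]
      simpa only [h2, h3] using h
    calc _ ≤ ∫⁻ y, (‖∑ i, y i * ∑ j, A' i j * star (y j) - ∑ i, A' i i‖ₑ ^ 2 +
          D * (‖A 0 0‖ₑ ^ 2 + ‖∑ j, A 0 (Fin.succ j) * star (y j)‖ₑ ^ 2 +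
            ‖∑ i, y i * A (Fin.succ i) 0‖ₑ ^ 2)) ∂π := by
          refine lintegral_mono fun y => ?_
          refine (lintegral_mono fun z => le_of_eq ?_).trans (hD (A 0 0)
            (∑ j, A 0 (Fin.succ j) * star (y j)) (∑ i, y i * A (Fin.succ i) 0)
            (∑ i, y i * ∑ j, A' i j * star (y j) - ∑ i, A' i i))
          congr 2
          simp only [Fin.sum_univ_succ, Fin.cons_zero, Fin.cons_succ, mul_add,
            Finset.sum_add_distrib, Finset.sum_mul, A', submatrix_apply]
          have : ∑ x, y x * (A (Fin.succ x) 0 * star z) = ∑ x, y x * A (Fin.succ x) 0 * star z :=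
            Finset.sum_congr rfl fun _ _ => by ring
          rw [this]
          ring
      _ = ∫⁻ y, ‖∑ i, y i * ∑ j, A' i j * star (y j) - ∑ i, A' i i‖ₑ ^ 2 ∂π +
          D * (‖A 0 0‖ₑ ^ 2 + ∫⁻ y, ‖∑ j, A 0 (Fin.succ j) * star (y j)‖ₑ ^ 2 ∂π +
            ∫⁻ y, ‖∑ i, y i * A (Fin.succ i) 0‖ₑ ^ 2 ∂π) := by
          rw [lintegral_add_right _ (by fun_prop), lintegral_const_mul _ (by fun_prop),
            lintegral_add_right _ (by fun_prop),
            lintegral_add_right _ (Continuous.measurable (by fun_prop))]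
          simp
      _ ≤ D ^ 2 * ∑ i, ∑ j, ‖A' i j‖ₑ ^ 2 + D * (D * ‖A 0 0‖ₑ ^ 2 +
          D * ∑ j, ‖A 0 (Fin.succ j)‖ₑ ^ 2 + D * ∑ i, ‖A (Fin.succ i) 0‖ₑ ^ 2) := by
          gcongr
          · exact ih A'
          · exact le_mul_of_one_le_left' (by exact_mod_cast hD1)
          · exact lintegral_linear_le hD _
      _ = _ := by
          simp only [Fin.sum_univ_succ, Finset.sum_add_distrib, A', submatrix_apply]
          ring

end QuadraticForm

section ResolventTrace

/-- The normalized trace `tr (U Q) / N` of a matrix against the resolvent. -/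
noncomputable def resolventTrace {K N : ℕ} (α : ℝ) (U : Matrix (Fin N) (Fin N) ℂ)
    (X : Fin K → Fin N → ℂ) : ℂ :=
  (N : ℂ)⁻¹ * trace (U * regResolvent N α X)

/-- The law of a `K × N` matrix with i.i.d. standard complex Gaussian entries. -/
noncomputable def gaussianRows (K N : ℕ) : Measure (Fin K → Fin N → ℂ) :=
  Measure.pi fun _ => Measure.pi fun _ => stdCGaussian

instance (K N : ℕ) : IsProbabilityMeasure (gaussianRows K N) := by
  unfold gaussianRows
  infer_instance

/-- The mean of the normalized resolvent trace under the Gaussian law. -/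
noncomputable def meanResolventTrace (K : ℕ) {N : ℕ} (α : ℝ) (U : Matrix (Fin N) (Fin N) ℂ) : ℂ :=
  ∫ X, resolventTrace α U X ∂gaussianRows K N

variable {K N : ℕ} {α : ℝ} {C : ℝ} {U : Matrix (Fin N) (Fin N) ℂ}

theorem continuous_regResolvent {m n : Type*} [Fintype m] [Fintype n] [DecidableEq n] (N : ℕ)
    (hα : 0 < α) : Continuous (regResolvent N α : (m → n → ℂ) → Matrix n n ℂ) := by
  have hG : Continuous (regGram N α : (m → n → ℂ) → Matrix n n ℂ) := by
    unfold regGram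
    have h : Continuous fun X : m → n → ℂ => (of X : Matrix m n ℂ) := continuous_id
    exact ((h.matrix_conjTranspose.matrix_mul h).const_smul ((N : ℂ)⁻¹)).add continuous_const
  have h : (regResolvent N α : (m → n → ℂ) → Matrix n n ℂ) =
      fun X => (det (regGram N α X))⁻¹ • adjugate (regGram N α X) := by
    ext1 X
    rw [regResolvent, inv_def, Ring.inverse_eq_inv']
  rw [h]
  exact (hG.matrix_det.inv₀ fun X => (posDef_regGram N hα X).det_pos.ne').smul hG.matrix_adjugate

theorem continuous_resolventTrace (hα : 0 < α) (U : Matrix (Fin N) (Fin N) ℂ) :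
    Continuous (resolventTrace α U : (Fin K → Fin N → ℂ) → ℂ) :=
  continuous_const.mul
    ((continuous_const.matrix_mul (continuous_regResolvent N hα)).matrix_trace)

theorem norm_natCast_inv_mul_trace_le (hN : N ≠ 0) (A : Matrix (Fin N) (Fin N) ℂ) :
    ‖(N : ℂ)⁻¹ * trace A‖ ≤ ‖A‖ := by
  rw [norm_mul, norm_inv, Complex.norm_natCast, inv_mul_le_iff₀ (by positivity)]
  simpa using norm_trace_le A

theorem norm_mul_regResolvent_le (hα : 0 < α) (hU : ‖U‖ ≤ C) (X : Fin K → Fin N → ℂ) :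
    ‖U * regResolvent N α X‖ ≤ C / α := by
  refine (l2_opNorm_mul _ _).trans ?_
  rw [div_eq_mul_inv]
  exact mul_le_mul hU (norm_resolvent_le N hα X) (norm_nonneg _) ((norm_nonneg _).trans hU)

theorem norm_resolventTrace_le (hN : N ≠ 0) (hα : 0 < α) (hU : ‖U‖ ≤ C)
    (X : Fin K → Fin N → ℂ) : ‖resolventTrace α U X‖ ≤ C / α :=
  (norm_natCast_inv_mul_trace_le hN _).trans (norm_mul_regResolvent_le hα hU X)

theorem integrable_resolventTrace (hN : N ≠ 0) (hα : 0 < α) (U : Matrix (Fin N) (Fin N) ℂ) :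
    Integrable (resolventTrace α U) (gaussianRows K N) :=
  Integrable.of_bound (continuous_resolventTrace hα U).measurable.aestronglyMeasurable _
    (.of_forall (norm_resolventTrace_le hN hα le_rfl))

theorem norm_meanResolventTrace_le (hN : N ≠ 0) (hα : 0 < α) (hU : ‖U‖ ≤ C) :
    ‖meanResolventTrace K α U‖ ≤ C / α := by
  have := norm_integral_le_of_norm_le_const (μ := gaussianRows K N)
    (.of_forall (norm_resolventTrace_le (K := K) hN hα hU))
  simpa [meanResolventTrace] using this

theorem re_meanResolventTrace_one_nonneg (hN : N ≠ 0) (hα : 0 < α) :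
    0 ≤ (meanResolventTrace K α (1 : Matrix (Fin N) (Fin N) ℂ)).re := by
  have h := integral_re (integrable_resolventTrace (K := K) hN hα (1 : Matrix (Fin N) (Fin N) ℂ))
  change _ = (meanResolventTrace K α (1 : Matrix (Fin N) (Fin N) ℂ)).re at h
  rw [← h]
  refine integral_nonneg fun X => ?_
  have ht : 0 ≤ trace (regResolvent N α X) := (posDef_regGram N hα X).inv.posSemidef.trace_nonneg
  change 0 ≤ (resolventTrace α 1 X).re
  rw [resolventTrace, one_mul, ← Complex.ofReal_natCast, ← Complex.ofReal_inv,
    Complex.re_ofReal_mul]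
  exact mul_nonneg (by positivity) (Complex.le_def.1 ht).1

theorem norm_resolventTrace_update_zero_sub_le (hN : N ≠ 0) (hα : 0 < α) (hU : ‖U‖ ≤ C)
    (X : Fin K → Fin N → ℂ) (k : Fin K) (r : Fin N → ℂ) :
    ‖resolventTrace α U (Function.update X k r) - resolventTrace α U (Function.update X k 0)‖ ≤
      C / (α * N) := by
  rw [resolventTrace, resolventTrace, ← mul_sub, norm_mul, norm_inv, Complex.norm_natCast,
    inv_mul_le_iff₀ (by positivity)]
  refine (norm_trace_resolvent_update_sub_le N hN hα X k r U).trans ?_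
  have : (N : ℝ) * (C / (α * N)) = C / α := by
    have : (N : ℝ) ≠ 0 := by positivity
    field_simp
  rw [this]
  gcongr

theorem norm_resolventTrace_update_sub_le (hN : N ≠ 0) (hα : 0 < α) (hU : ‖U‖ ≤ C)
    (X : Fin K → Fin N → ℂ) (k : Fin K) (r : Fin N → ℂ) :
    ‖resolventTrace α U (Function.update X k r) - resolventTrace α U X‖ ≤ 2 * C / (α * N) := by
  have h1 := norm_resolventTrace_update_zero_sub_le hN hα hU X k r
  have h2 := norm_resolventTrace_update_zero_sub_le hN hα hU X k (X k)
  rw [Function.update_eq_self] at h2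
  have h3 := norm_sub_le_norm_sub_add_norm_sub (resolventTrace α U (Function.update X k r))
    (resolventTrace α U (Function.update X k 0)) (resolventTrace α U X)
  rw [norm_sub_rev (resolventTrace α U (Function.update X k 0))] at h3
  refine h3.trans ((add_le_add h1 h2).trans_eq ?_)
  ring

/-- The variance proxy of the normalized resolvent trace. -/
noncomputable def traceProxy (K N : ℕ) (α C : ℝ) : ℝ≥0 := K * (2 * C / (α * N)).toNNReal ^ 2

theorem coe_traceProxy (hα : 0 < α) (hC : 0 ≤ C) :
    (traceProxy K N α C : ℝ) = K * (2 * C / (α * N)) ^ 2 := by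
  rw [traceProxy, NNReal.coe_mul, NNReal.coe_pow, Real.coe_toNNReal _ (by positivity),
    NNReal.coe_natCast]

theorem hasSubgaussianMGF_clm_resolventTrace (hN : N ≠ 0) (hα : 0 < α) (hU : ‖U‖ ≤ C)
    (L : ℂ →L[ℝ] ℝ) (hL : ∀ z, |L z| ≤ ‖z‖) :
    HasSubgaussianMGF (fun X => L (resolventTrace α U X - meanResolventTrace K α U))
      (traceProxy K N α C) (gaussianRows K N) := by
  have hC : 0 ≤ C := (norm_nonneg _).trans hU
  have h := hasSubgaussianMGF_of_bounded_differences (Measure.pi fun _ : Fin N => stdCGaussian)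
    (2 * C / (α * N)).toNNReal (n := K) (fun X => L (resolventTrace α U X))
    (L.continuous.comp (continuous_resolventTrace hα U)).measurable (B := C / α)
    (fun X => (hL _).trans (norm_resolventTrace_le hN hα hU X)) fun X k r => by
      rw [Real.coe_toNNReal _ (by positivity), ← map_sub]
      exact (hL _).trans (norm_resolventTrace_update_sub_le hN hα hU X k r)
  have h2 : ∫ X, L (resolventTrace α U X) ∂gaussianRows K N = L (meanResolventTrace K α U) :=
    L.integral_comp_comm (integrable_resolventTrace hN hα U)
  simp only [map_sub, ← h2]
  exact h

theorem hasSubgaussianMGF_re_resolventTrace (hN : N ≠ 0) (hα : 0 < α) (hU : ‖U‖ ≤ C) :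
    HasSubgaussianMGF (fun X => (resolventTrace α U X - meanResolventTrace K α U).re)
      (traceProxy K N α C) (gaussianRows K N) :=
  hasSubgaussianMGF_clm_resolventTrace hN hα hU Complex.reCLM Complex.abs_re_le_norm

theorem hasSubgaussianMGF_im_resolventTrace (hN : N ≠ 0) (hα : 0 < α) (hU : ‖U‖ ≤ C) :
    HasSubgaussianMGF (fun X => (resolventTrace α U X - meanResolventTrace K α U).im)
      (traceProxy K N α C) (gaussianRows K N) :=
  hasSubgaussianMGF_clm_resolventTrace hN hα hU Complex.imCLM Complex.abs_im_le_norm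

theorem integral_norm_resolventTrace_sub_mean_le (hN : N ≠ 0) (hα : 0 < α) (hU : ‖U‖ ≤ C) :
    ∫ X, ‖resolventTrace α U X - meanResolventTrace K α U‖ ∂gaussianRows K N ≤
      4 * Real.exp (2 * (K / N) * (C / α) ^ 2) / √N := by
  have hC : 0 ≤ C := (norm_nonneg _).trans hU
  have hN' : (0 : ℝ) < N := by positivity
  have hre := hasSubgaussianMGF_re_resolventTrace (K := K) hN hα hU
  have him := hasSubgaussianMGF_im_resolventTrace (K := K) hN hα hU
  have ht : 0 < √(N : ℝ) := Real.sqrt_pos.2 hN'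
  have hexp : (traceProxy K N α C : ℝ) * √(N : ℝ) ^ 2 / 2 = 2 * (K / N) * (C / α) ^ 2 := by
    rw [coe_traceProxy hα hC, Real.sq_sqrt hN'.le]
    field_simp
  have h1 := integral_abs_le_of_hasSubgaussianMGF hre ht
  have h2 := integral_abs_le_of_hasSubgaussianMGF him ht
  rw [hexp] at h1 h2
  calc _ ≤ ∫ X, (|(resolventTrace α U X - meanResolventTrace K α U).re| +
        |(resolventTrace α U X - meanResolventTrace K α U).im|) ∂gaussianRows K N :=
        integral_mono (((integrable_resolventTrace hN hα U).sub (integrable_const _)).norm)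
          (hre.integrable.abs.add him.integrable.abs) fun X => Complex.norm_le_abs_re_add_abs_im _
    _ ≤ _ := by
        rw [integral_add hre.integrable.abs him.integrable.abs]
        refine (add_le_add h1 h2).trans_eq ?_
        ring

theorem measureReal_norm_resolventTrace_sub_mean_ge_le (hN : N ≠ 0) (hα : 0 < α) (hU : ‖U‖ ≤ C)
    {Ω : Type*} [MeasurableSpace Ω] {μ : Measure Ω} [IsProbabilityMeasure μ]
    {Y : Ω → Fin K → Fin N → ℂ} (hY : Measurable Y) (hlaw : μ.map Y = gaussianRows K N)
    {ε : ℝ} (hε : 0 < ε) :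
    μ.real {ω | ε ≤ ‖resolventTrace α U (Y ω) - meanResolventTrace K α U‖} ≤
      4 * Real.exp (-(ε / 2) ^ 2 / (2 * traceProxy K N α C)) := by
  have hre := hasSubgaussianMGF_re_resolventTrace (K := K) hN hα hU
  have him := hasSubgaussianMGF_im_resolventTrace (K := K) hN hα hU
  rw [← hlaw] at hre him
  have hre' := hre.of_map hY.aemeasurable
  have him' := him.of_map hY.aemeasurable
  have h1 := hre'.measure_ge_le (half_pos hε).le
  have h2 := hre'.neg.measure_ge_le (half_pos hε).le
  have h3 := him'.measure_ge_le (half_pos hε).le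
  have h4 := him'.neg.measure_ge_le (half_pos hε).le
  have hsub : {ω | ε ≤ ‖resolventTrace α U (Y ω) - meanResolventTrace K α U‖} ⊆
      (({ω | ε / 2 ≤ ((fun X => (resolventTrace α U X - meanResolventTrace K α U).re) ∘ Y) ω} ∪
      {ω | ε / 2 ≤ (-((fun X => (resolventTrace α U X - meanResolventTrace K α U).re) ∘ Y)) ω}) ∪
      {ω | ε / 2 ≤ ((fun X => (resolventTrace α U X - meanResolventTrace K α U).im) ∘ Y) ω}) ∪
      {ω | ε / 2 ≤ (-((fun X => (resolventTrace α U X - meanResolventTrace K α U).im) ∘ Y)) ω} := by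
    intro ω hω
    simp only [Set.mem_ofPred_eq] at hω
    simp only [Set.mem_union, Set.mem_ofPred_eq, Function.comp_apply, Pi.neg_apply]
    by_contra! hcon
    obtain ⟨⟨⟨c1, c2⟩, c3⟩, c4⟩ := hcon
    have := Complex.norm_le_abs_re_add_abs_im (resolventTrace α U (Y ω) - meanResolventTrace K α U)
    have a1 := abs_lt.2 ⟨neg_lt.1 c2, c1⟩
    have a2 := abs_lt.2 ⟨neg_lt.1 c4, c3⟩
    linarith
  refine (measureReal_mono hsub).trans ?_
  refine (measureReal_union_le _ _).trans ?_
  refine (add_le_add_left ((measureReal_union_le _ _).trans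
    (add_le_add_left (measureReal_union_le _ _) _)) _).trans ?_
  linarith

end ResolventTrace

section MeanEquation

variable {K N : ℕ} {α : ℝ} {C : ℝ} {U : Matrix (Fin N) (Fin N) ℂ}

theorem continuous_rowForm {n : Type*} [Fintype n] (N : ℕ) :
    Continuous fun p : Matrix n n ℂ × (n → ℂ) => rowForm N p.1 p.2 := by
  unfold rowForm
  exact continuous_const.mul (continuous_snd.dotProduct
    (continuous_fst.matrix_mulVec continuous_snd.star))

theorem exists_lintegral_rowForm_sub_trace_le :
    ∃ D : ℝ, 0 ≤ D ∧ ∀ (N : ℕ) (_ : N ≠ 0) (B : ℝ) (A : Matrix (Fin N) (Fin N) ℂ), ‖A‖ ≤ B →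
      ∫⁻ r, ‖rowForm N A r - (N : ℂ)⁻¹ * trace A‖ₑ ∂(Measure.pi fun _ => stdCGaussian) ≤
        ENNReal.ofReal ((D * B ^ 2 + 1) / √N) := by
  obtain ⟨D, hD1, hD⟩ := exists_lintegral_quadratic_le stdCGaussian memLp_id_stdCGaussian
    integral_id_stdCGaussian integral_norm_sq_stdCGaussian
  refine ⟨D ^ 2, by positivity, fun N hN B A hA => ?_⟩
  have hN' : (0 : ℝ) < N := by positivity
  have hs : 0 < √(N : ℝ) := Real.sqrt_pos.2 hN'
  have hsq : √(N : ℝ) * √N = N := Real.mul_self_sqrt hN'.le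
  have hpt : ∀ r : Fin N → ℂ, ‖rowForm N A r - (N : ℂ)⁻¹ * trace A‖ₑ ≤
      ENNReal.ofReal ((N * √N)⁻¹) * ‖r ⬝ᵥ A *ᵥ star r - trace A‖ₑ ^ 2 +
        ENNReal.ofReal (1 / √N) := fun r => by
    rw [rowForm, ← mul_sub, ← ofReal_norm, ← ofReal_norm,
      ← ENNReal.ofReal_pow (norm_nonneg _), ← ENNReal.ofReal_mul (by positivity),
      ← ENNReal.ofReal_add (by positivity) (by positivity)]
    refine ENNReal.ofReal_le_ofReal ?_
    rw [norm_mul, norm_inv, Complex.norm_natCast]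
    generalize ‖r ⬝ᵥ A *ᵥ star r - trace A‖ = a
    generalize √(N : ℝ) = s at *
    rw [← hsq]
    have : (s * s * s)⁻¹ * a ^ 2 + 1 / s - (s * s)⁻¹ * a =
      s⁻¹ * ((a / s - 1 / 2) ^ 2 + 3 / 4) := by field_simp; ring
    have h2 : 0 ≤ s⁻¹ * ((a / s - 1 / 2) ^ 2 + 3 / 4) := by positivity
    linarith
  have hm : Measurable fun r : Fin N → ℂ => ‖r ⬝ᵥ A *ᵥ star r - trace A‖ₑ ^ 2 := by
    have : Continuous fun r : Fin N → ℂ => r ⬝ᵥ A *ᵥ star r - trace A :=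
      (continuous_id.dotProduct (continuous_const.matrix_mulVec continuous_id.star)).sub
        continuous_const
    exact this.enorm.measurable.pow_const 2
  have hsum : ∑ i, ∑ j, ‖A i j‖ₑ ^ 2 ≤ ENNReal.ofReal (N * B ^ 2) := by
    have h1 : ∑ i, ∑ j, ‖A i j‖ₑ ^ 2 = ENNReal.ofReal (∑ i, ∑ j, ‖A i j‖ ^ 2) := by
      rw [ENNReal.ofReal_sum_of_nonneg fun _ _ => by positivity]
      refine Finset.sum_congr rfl fun i _ => ?_
      rw [ENNReal.ofReal_sum_of_nonneg fun _ _ => by positivity]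
      refine Finset.sum_congr rfl fun j _ => ?_
      rw [ENNReal.ofReal_pow (norm_nonneg _), ofReal_norm]
    rw [h1]
    refine ENNReal.ofReal_le_ofReal ((sum_norm_sq_le A).trans ?_)
    rw [Fintype.card_fin]
    gcongr
  refine (lintegral_mono hpt).trans ?_
  rw [lintegral_add_right _ measurable_const, lintegral_const_mul _ hm, lintegral_const,
    measure_univ, mul_one]
  refine (add_le_add_left (mul_le_mul_right ((lintegral_quadForm_sub_trace_le hD1 hD A).trans
    (mul_le_mul_right hsum _)) _) _).trans ?_
  rw [← ENNReal.ofReal_coe_nnreal, ← ENNReal.ofReal_pow (by positivity),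
    ← ENNReal.ofReal_mul (by positivity), ← ENNReal.ofReal_mul (by positivity),
      ← ENNReal.ofReal_add (by positivity) (by positivity)]
  refine ENNReal.ofReal_le_ofReal (le_of_eq ?_)
  field_simp

theorem lintegral_pi_le_of_forall_update {ι : Type*} [Fintype ι] [DecidableEq ι] {E : Type*}
    [MeasurableSpace E] (ν : Measure E) [IsProbabilityMeasure ν] {f : (ι → E) → ℝ≥0∞}
    (hf : Measurable f) (k : ι) {c : ℝ≥0∞}
    (h : ∀ x, ∫⁻ y, f (Function.update x k y) ∂ν ≤ c) :
    ∫⁻ x, f x ∂(Measure.pi fun _ => ν) ≤ c := by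
  refine (lintegral_le_of_lmarginal_le (g := fun _ => c) (μ := fun _ => ν) {k} hf
    measurable_const fun x => ?_).trans_eq (by simp)
  simpa [lmarginal_singleton] using h x

/-- The error made by replacing a row form by the mean resolvent trace. -/
noncomputable def rowError (D : ℝ) (K N : ℕ) (α C : ℝ) : ℝ :=
  (D * (C / α) ^ 2 + 1) / √N + C / (α * N) + 4 * Real.exp (2 * (K / N) * (C / α) ^ 2) / √N

theorem continuous_rowForm_resolvent (hα : 0 < α) (U : Matrix (Fin N) (Fin N) ℂ) (k : Fin K) :
    Continuous fun X : Fin K → Fin N → ℂ =>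
      rowForm N (U * regResolvent N α (Function.update X k 0)) (X k) :=
  (continuous_rowForm N).comp (Continuous.prodMk (continuous_const.matrix_mul
    ((continuous_regResolvent N hα).comp (continuous_id.update k continuous_const)))
    (continuous_apply k))

theorem lintegral_rowForm_sub_mean_le {D : ℝ} (hD0 : 0 ≤ D)
    (hD : ∀ (N : ℕ) (_ : N ≠ 0) (B : ℝ) (A : Matrix (Fin N) (Fin N) ℂ), ‖A‖ ≤ B →
      ∫⁻ r, ‖rowForm N A r - (N : ℂ)⁻¹ * trace A‖ₑ ∂(Measure.pi fun _ => stdCGaussian) ≤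
        ENNReal.ofReal ((D * B ^ 2 + 1) / √N))
    (hN : N ≠ 0) (hα : 0 < α) (hU : ‖U‖ ≤ C) (k : Fin K) :
    ∫⁻ X, ‖rowForm N (U * regResolvent N α (Function.update X k 0)) (X k) -
      meanResolventTrace K α U‖ₑ ∂gaussianRows K N ≤ ENNReal.ofReal (rowError D K N α C) := by
  have hC : 0 ≤ C := (norm_nonneg _).trans hU
  have hcy := continuous_rowForm_resolvent (K := K) hα U k
  have hcT : Continuous fun X : Fin K → Fin N → ℂ =>
      resolventTrace α U (Function.update X k 0) :=
    (continuous_resolventTrace hα U).comp (continuous_id.update k continuous_const)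
  have h1 : ∫⁻ X, ‖rowForm N (U * regResolvent N α (Function.update X k 0)) (X k) -
      resolventTrace α U (Function.update X k 0)‖ₑ ∂gaussianRows K N ≤
        ENNReal.ofReal ((D * (C / α) ^ 2 + 1) / √N) := by
    have hm : Measurable fun X : Fin K → Fin N → ℂ =>
        ‖rowForm N (U * regResolvent N α (Function.update X k 0)) (X k) -
          resolventTrace α U (Function.update X k 0)‖ₑ := (hcy.sub hcT).enorm.measurable
    refine lintegral_pi_le_of_forall_update _ hm k fun X => ?_
    simp only [Function.update_idem, Function.update_self]
    exact hD N hN _ _ (norm_mul_regResolvent_le hα hU _)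
  have h2 : ∀ X : Fin K → Fin N → ℂ, ‖resolventTrace α U (Function.update X k 0) -
      resolventTrace α U X‖ₑ ≤ ENNReal.ofReal (C / (α * N)) := fun X => by
    rw [← ofReal_norm, norm_sub_rev]
    refine ENNReal.ofReal_le_ofReal ?_
    simpa using norm_resolventTrace_update_zero_sub_le hN hα hU X k (X k)
  have h3 : ∫⁻ X, ‖resolventTrace α U X - meanResolventTrace K α U‖ₑ ∂gaussianRows K N ≤
      ENNReal.ofReal (4 * Real.exp (2 * (K / N) * (C / α) ^ 2) / √N) := by
    have hi : Integrable (fun X => resolventTrace α U X - meanResolventTrace K α U)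
        (gaussianRows K N) := (integrable_resolventTrace hN hα U).sub (integrable_const _)
    rw [← ofReal_integral_norm_eq_lintegral_enorm hi]
    exact ENNReal.ofReal_le_ofReal (integral_norm_resolventTrace_sub_mean_le hN hα hU)
  rw [rowError, ENNReal.ofReal_add (by positivity) (by positivity),
    ENNReal.ofReal_add (by positivity) (by positivity)]
  calc _ ≤ ∫⁻ X, (‖rowForm N (U * regResolvent N α (Function.update X k 0)) (X k) -
      resolventTrace α U (Function.update X k 0)‖ₑ + ENNReal.ofReal (C / (α * N)) +
      ‖resolventTrace α U X - meanResolventTrace K α U‖ₑ) ∂gaussianRows K N := by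
        refine lintegral_mono fun X => ?_
        refine le_trans ?_ (add_le_add_left (add_le_add_right (h2 X) _) _)
        refine le_trans ?_ (add_le_add_left (enorm_add_le _ _) _)
        refine le_trans ?_ (enorm_add_le _ _)
        rw [sub_add_sub_cancel, sub_add_sub_cancel]
    _ ≤ _ := by
        have hm : Measurable fun X : Fin K → Fin N → ℂ =>
            ‖resolventTrace α U X - meanResolventTrace K α U‖ₑ :=
          ((continuous_resolventTrace hα U).sub continuous_const).enorm.measurable
        rw [lintegral_add_right _ hm, lintegral_add_right _ measurable_const,
          lintegral_const, measure_univ, mul_one]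
        gcongr

theorem norm_div_one_add_sub_le {x y m u : ℂ} (hx : 0 ≤ x.re) (hm : 0 ≤ m.re) :
    ‖y / (1 + x) - u / (1 + m)‖ ≤ ‖y - u‖ + ‖u‖ * ‖x - m‖ := by
  have hx0 := one_add_ne_zero_of_re_nonneg hx
  have hm0 := one_add_ne_zero_of_re_nonneg hm
  have h : y / (1 + x) - u / (1 + m) = (y - u) / (1 + x) - u * (x - m) / ((1 + x) * (1 + m)) := by
    field_simp
    ring
  rw [h]
  refine (norm_sub_le _ _).trans (add_le_add ?_ ?_)
  · rw [norm_div]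
    exact div_le_self (norm_nonneg _) (one_le_norm_one_add hx)
  · rw [norm_div, norm_mul, norm_mul]
    exact div_le_self (by positivity)
      (one_le_mul_of_one_le_of_one_le (one_le_norm_one_add hx) (one_le_norm_one_add hm))

/-- The approximate fixed-point equation satisfied by the mean resolvent trace. -/
theorem norm_mean_equation_le {D : ℝ} (hD0 : 0 ≤ D)
    (hD : ∀ (N : ℕ) (_ : N ≠ 0) (B : ℝ) (A : Matrix (Fin N) (Fin N) ℂ), ‖A‖ ≤ B →
      ∫⁻ r, ‖rowForm N A r - (N : ℂ)⁻¹ * trace A‖ₑ ∂(Measure.pi fun _ => stdCGaussian) ≤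
        ENNReal.ofReal ((D * B ^ 2 + 1) / √N))
    (hN : N ≠ 0) (hα : 0 < α) (hC : 1 ≤ C) (hU : ‖U‖ ≤ C) :
    ‖(N : ℂ)⁻¹ * trace U - α * meanResolventTrace K α U -
      (K / N : ℂ) * (meanResolventTrace K α U / (1 + meanResolventTrace K α
        (1 : Matrix (Fin N) (Fin N) ℂ)))‖ ≤ K / N * ((1 + C / α) * rowError D K N α C) := by
  set u := meanResolventTrace K α U with hu
  set m := meanResolventTrace K α (1 : Matrix (Fin N) (Fin N) ℂ) with hm
  have hN' : (0 : ℝ) < N := by positivity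
  have hNc : (N : ℂ) ≠ 0 := by exact_mod_cast hN
  have hmre : 0 ≤ m.re := re_meanResolventTrace_one_nonneg hN hα
  have hub : ‖u‖ ≤ C / α := norm_meanResolventTrace_le hN hα hU
  have hone : ‖(1 : Matrix (Fin N) (Fin N) ℂ)‖ ≤ C := by
    have : NeZero N := ⟨hN⟩
    exact (by simp : ‖(1 : Matrix (Fin N) (Fin N) ℂ)‖ = 1).trans_le hC
  have hE0 : 0 ≤ rowError D K N α C := by
    have : 0 ≤ C := zero_le_one.trans hC
    unfold rowError
    positivity
  set y : Fin K → (Fin K → Fin N → ℂ) → ℂ := fun k X =>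
    rowForm N (U * regResolvent N α (Function.update X k 0)) (X k) with hy
  set x : Fin K → (Fin K → Fin N → ℂ) → ℂ := fun k X =>
    rowForm N (1 * regResolvent N α (Function.update X k 0)) (X k) with hx
  have hxre : ∀ k X, 0 ≤ (x k X).re := fun k X => by
    simp only [hx, one_mul]
    exact re_rowForm_nonneg N hα _ _
  have hid : ∀ X : Fin K → Fin N → ℂ, (N : ℂ)⁻¹ * trace U - α * resolventTrace α U X -
      (K / N : ℂ) * (u / (1 + m)) =
      (N : ℂ)⁻¹ * ∑ k, (y k X / (1 + x k X) - u / (1 + m)) := fun X => by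
    rw [trace_eq_add_sum_rowForm N hα X U, resolventTrace, Finset.sum_sub_distrib]
    simp only [hy, hx, one_mul, Finset.sum_const, Finset.card_univ, Fintype.card_fin, nsmul_eq_mul]
    field_simp
    ring
  have h_int : (N : ℂ)⁻¹ * trace U - α * u - (K / N : ℂ) * (u / (1 + m)) =
      ∫ X, ((N : ℂ)⁻¹ * trace U - α * resolventTrace α U X - (K / N : ℂ) * (u / (1 + m)))
        ∂gaussianRows K N := by
    have hi := (integrable_resolventTrace (K := K) hN hα U).const_mul (α : ℂ)
    have hi' : Integrable (fun X => (N : ℂ)⁻¹ * trace U - α * resolventTrace α U X)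
        (gaussianRows K N) := (integrable_const _).sub hi
    rw [integral_sub hi' (integrable_const _), integral_sub (integrable_const _) hi,
      integral_const_mul (α : ℂ)]
    simp [hu, meanResolventTrace]
  have hmy : ∀ k, Measurable fun X => ‖y k X - u‖ₑ := fun k =>
    ((continuous_rowForm_resolvent hα U k).sub continuous_const).enorm.measurable
  have hmx : ∀ k, Measurable fun X => ‖x k X - m‖ₑ := fun k =>
    ((continuous_rowForm_resolvent hα 1 k).sub continuous_const).enorm.measurable
  rw [h_int]
  simp only [hid]
  rw [← ENNReal.ofReal_le_ofReal_iff (by positivity), ofReal_norm]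
  refine (enorm_integral_le_lintegral_enorm _).trans ?_
  calc _ ≤ ∫⁻ X, ENNReal.ofReal ((N : ℝ)⁻¹) * ∑ k, (‖y k X - u‖ₑ +
        ENNReal.ofReal (C / α) * ‖x k X - m‖ₑ) ∂gaussianRows K N := by
        refine lintegral_mono fun X => ?_
        have hNe : ‖(N : ℂ)⁻¹‖ₑ = ENNReal.ofReal ((N : ℝ)⁻¹) := by
          rw [← ofReal_norm, norm_inv, Complex.norm_natCast]
        rw [enorm_mul, hNe]
        gcongr
        refine (enorm_sum_le _ _).trans (Finset.sum_le_sum fun k _ => ?_)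
        simp only [← ofReal_norm]
        rw [← ENNReal.ofReal_mul (by positivity), ← ENNReal.ofReal_add (by positivity)
          (by positivity)]
        refine ENNReal.ofReal_le_ofReal ((norm_div_one_add_sub_le (hxre k X) hmre).trans ?_)
        gcongr
    _ = ENNReal.ofReal ((N : ℝ)⁻¹) * ∑ k, (∫⁻ X, ‖y k X - u‖ₑ ∂gaussianRows K N +
        ENNReal.ofReal (C / α) * ∫⁻ X, ‖x k X - m‖ₑ ∂gaussianRows K N) := by
        have hms : ∀ k ∈ Finset.univ, Measurable fun X => ‖y k X - u‖ₑ +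
            ENNReal.ofReal (C / α) * ‖x k X - m‖ₑ := fun k _ => (hmy k).add ((hmx k).const_mul _)
        rw [lintegral_const_mul _ (Finset.measurable_fun_sum _ hms), lintegral_finsetSum _ hms]
        congr 1
        refine Finset.sum_congr rfl fun k _ => ?_
        rw [lintegral_add_left (hmy k), lintegral_const_mul _ (hmx k)]
    _ ≤ ENNReal.ofReal ((N : ℝ)⁻¹) * ∑ _k : Fin K, (ENNReal.ofReal (rowError D K N α C) +
        ENNReal.ofReal (C / α) * ENNReal.ofReal (rowError D K N α C)) := by
        gcongr with k
        · exact lintegral_rowForm_sub_mean_le hD0 hD hN hα hU k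
        · exact lintegral_rowForm_sub_mean_le hD0 hD hN hα hone k
    _ = _ := by
        rw [Finset.sum_const, Finset.card_univ, Fintype.card_fin, nsmul_eq_mul,
          ← ENNReal.ofReal_mul (by positivity), ← ENNReal.ofReal_add hE0 (by positivity),
          ← ENNReal.ofReal_natCast, ← ENNReal.ofReal_mul (by positivity),
          ← ENNReal.ofReal_mul (by positivity)]
        congr 1
        ring

end MeanEquation

section DeterministicLimit

theorem le_norm_ofReal_add_mul_inv {a c : ℝ} (hc : 0 ≤ c) {z : ℂ} (hz : 0 ≤ z.re) :
    a ≤ ‖(a : ℂ) + c * (1 + z)⁻¹‖ := by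
  refine le_trans ?_ (Complex.re_le_norm _)
  rw [Complex.add_re, Complex.ofReal_re, Complex.re_ofReal_mul, Complex.inv_re]
  have : 0 ≤ (1 + z).re := by simp; linarith
  have := Complex.normSq_nonneg (1 + z)
  exact le_add_of_nonneg_right (by positivity)

/-- Asymptotic solutions of the fixed-point equation converge to its solution. -/
theorem tendsto_of_tendsto_fixedPoint_equation {α κ δ : ℝ} (hα : 0 < α) {k : ℕ → ℝ}
    (hk0 : ∀ K, 0 ≤ k K) (hk : Tendsto k atTop (nhds κ)) (hδ0 : 0 ≤ δ)
    (hδ : α * δ + κ * (δ / (1 + δ)) = 1) {m : ℕ → ℂ} (hm0 : ∀ᶠ K in atTop, 0 ≤ (m K).re)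
    (hm : Tendsto (fun K => 1 - α * m K - k K * (m K / (1 + m K))) atTop (nhds 0)) :
    Tendsto m atTop (nhds (δ : ℂ)) := by
  have h1δ : (1 + δ : ℂ) ≠ 0 := by exact_mod_cast (by positivity : (1 + δ) ≠ 0)
  have hlim : Tendsto (fun K => α * δ + k K * (δ / (1 + δ))) atTop (nhds 1) := by
    have h := (hk.mul_const (δ / (1 + δ))).const_add (α * δ)
    rwa [hδ] at h
  have hdiff : Tendsto (fun K => ((α * δ + k K * (δ / (1 + δ)) : ℝ) : ℂ) - 1 +
      (1 - α * m K - k K * (m K / (1 + m K)))) atTop (nhds 0) := by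
    simpa using (((Complex.continuous_ofReal.tendsto _).comp hlim).sub_const 1).add hm
  rw [tendsto_iff_norm_sub_tendsto_zero]
  refine squeeze_zero' (.of_forall fun _ => norm_nonneg _) ?_
    (by simpa only [norm_zero, mul_zero] using hdiff.norm.const_mul α⁻¹)
  filter_upwards [hm0] with K hK
  have h1 : (1 + m K) ≠ 0 := fun h => by
    have := congrArg Complex.re h
    simp at this
    linarith
  have hid : ((α * δ + k K * (δ / (1 + δ)) : ℝ) : ℂ) - 1 +
      (1 - α * m K - k K * (m K / (1 + m K))) =
      -((m K - δ) * (α + (k K / (1 + δ) : ℝ) * (1 + m K)⁻¹)) := by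
    push_cast
    field_simp
    ring
  rw [hid, norm_neg, norm_mul, ← div_eq_inv_mul, le_div_iff₀ hα]
  have := hk0 K
  exact mul_le_mul_of_nonneg_left (le_norm_ofReal_add_mul_inv (by positivity) hK) (norm_nonneg _)

theorem tendsto_sub_of_tendsto_linear_equation {α κ δ B : ℝ} {k : ℕ → ℝ}
    (hk : Tendsto k atTop (nhds κ)) (hδ0 : 0 ≤ δ)
    (hδ : α * δ + κ * (δ / (1 + δ)) = 1) {m u t : ℕ → ℂ}
    (hm : Tendsto m atTop (nhds (δ : ℂ))) (hu : ∀ᶠ K in atTop, ‖u K‖ ≤ B)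
    (h : Tendsto (fun K => t K - α * u K - k K * (u K / (1 + m K))) atTop (nhds 0)) :
    Tendsto (fun K => u K - δ * t K) atTop (nhds 0) := by
  have h1δ : (1 + δ : ℂ) ≠ 0 := by exact_mod_cast (by positivity : (1 + δ) ≠ 0)
  have hg : Tendsto (fun K => 1 - δ * (α + k K * (1 + m K)⁻¹)) atTop (nhds (0 : ℂ)) := by
    have h0 : (0 : ℂ) = 1 - δ * (α + κ * (1 + (δ : ℂ))⁻¹) := by
      have := congrArg (fun x : ℝ => (x : ℂ)) hδ
      push_cast at this
      linear_combination this
    rw [h0]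
    exact ((((Complex.continuous_ofReal.tendsto _).comp hk).mul
      ((hm.const_add 1).inv₀ h1δ)).const_add _).const_mul _ |>.const_sub _
  have h2 : Tendsto (fun K => u K * (1 - δ * (α + k K * (1 + m K)⁻¹))) atTop (nhds 0) := by
    refine squeeze_zero_norm' ?_ (by simpa using hg.norm.const_mul B)
    filter_upwards [hu] with K hK
    rw [norm_mul]
    gcongr
  have h3 := (h.const_mul (-δ : ℂ)).add h2
  rw [mul_zero, add_zero] at h3
  refine h3.congr fun K => ?_
  ring

end DeterministicLimit

section Probability

theorem map_curry_pi {ι κ E : Type*} [Fintype ι] [Fintype κ] [MeasurableSpace E]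
    (ν : Measure E) [IsProbabilityMeasure ν] :
    (Measure.pi fun _ : ι × κ => ν).map (fun f i j => f (i, j)) =
      Measure.pi fun _ : ι => Measure.pi fun _ : κ => ν := by
  have hunc : Measurable fun (g : ι → κ → E) (p : ι × κ) => g p.1 p.2 := by fun_prop
  have hcur : Measurable fun (f : ι × κ → E) (i : ι) (j : κ) => f (i, j) := by fun_prop
  have h : (Measure.pi fun _ : ι × κ => ν) =
      (Measure.pi fun _ : ι => Measure.pi fun _ : κ => ν).map fun g p => g p.1 p.2 := by
    refine Measure.pi_eq fun s hs => ?_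
    rw [Measure.map_apply hunc (MeasurableSet.univ_pi hs)]
    have : (fun (g : ι → κ → E) (p : ι × κ) => g p.1 p.2) ⁻¹' Set.univ.pi s =
        Set.univ.pi fun i => Set.univ.pi fun j => s (i, j) := by
      ext g
      simp [Set.mem_pi]
    rw [this, Measure.pi_pi, Fintype.prod_prod_type]
    simp only [Measure.pi_pi]
  rw [h, Measure.map_map hcur hunc]
  exact Measure.map_id

theorem ae_tendsto_zero_of_summable {Ω E : Type*} [MeasurableSpace Ω] {μ : Measure Ω}
    [IsFiniteMeasure μ] [SeminormedAddCommGroup E] {Z : ℕ → Ω → E}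
    (h : ∀ ε : ℝ, 0 < ε → Summable fun K => μ.real {ω | ε ≤ ‖Z K ω‖}) :
    ∀ᵐ ω ∂μ, Tendsto (fun K => Z K ω) atTop (nhds 0) := by
  have h1 : ∀ j : ℕ, ∀ᵐ ω ∂μ, ∀ᶠ K in atTop, ω ∉ {ω | 1 / ((j : ℝ) + 1) ≤ ‖Z K ω‖} := fun j => by
    refine ae_eventually_notMem ?_
    have := (h _ (Nat.one_div_pos_of_nat (n := j))).tsum_ofReal_ne_top
    exact (tsum_congr fun K => (ofReal_measureReal (measure_ne_top _ _)).symm).trans_ne this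
  filter_upwards [ae_all_iff.2 h1] with ω hω
  rw [tendsto_zero_iff_norm_tendsto_zero, Metric.tendsto_nhds]
  intro ε hε
  obtain ⟨j, hj⟩ := exists_nat_one_div_lt hε
  filter_upwards [hω j] with K hK
  simpa using (not_le.1 hK).trans hj

end Probability

section AlmostSureLimit

variable {α β C : ℝ} {M : ℕ → ℕ}

theorem tendsto_rowError (D α C : ℝ) {κ : ℝ} (hM : Tendsto M atTop atTop)
    (hk : Tendsto (fun K : ℕ => (K : ℝ) / M K) atTop (nhds κ)) :
    Tendsto (fun K => rowError D K (M K) α C) atTop (nhds 0) := by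
  have hMr : Tendsto (fun K => (M K : ℝ)) atTop atTop := tendsto_natCast_atTop_atTop.comp hM
  have hs : Tendsto (fun K => (√(M K : ℝ))⁻¹) atTop (nhds 0) :=
    (Real.tendsto_sqrt_atTop.comp hMr).inv_tendsto_atTop
  have h1 := hs.const_mul (D * (C / α) ^ 2 + 1)
  have h2 := hMr.inv_tendsto_atTop.const_mul (C / α)
  have h3 := ((Real.continuous_exp.tendsto _).comp
    ((hk.const_mul 2).mul_const ((C / α) ^ 2))).const_mul 4 |>.mul hs
  have h := (h1.add h2).add h3
  simp only [mul_zero, add_zero] at h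
  refine h.congr fun K => ?_
  simp only [rowError, Function.comp_apply, Pi.inv_apply]
  ring

theorem tendsto_mean_equation (hα : 0 < α) (hC : 1 ≤ C) {κ : ℝ} (hM : Tendsto M atTop atTop)
    (hk : Tendsto (fun K : ℕ => (K : ℝ) / M K) atTop (nhds κ))
    {U : ∀ K, Matrix (Fin (M K)) (Fin (M K)) ℂ} (hU : ∀ K, ‖U K‖ ≤ C) :
    Tendsto (fun K => (M K : ℂ)⁻¹ * trace (U K) - α * meanResolventTrace K α (U K) -
      ((K / M K : ℝ) : ℂ) * (meanResolventTrace K α (U K) / (1 + meanResolventTrace K α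
        (1 : Matrix (Fin (M K)) (Fin (M K)) ℂ)))) atTop (nhds 0) := by
  obtain ⟨D, hD0, hD⟩ := exists_lintegral_rowForm_sub_trace_le
  have hlim := hk.mul ((tendsto_rowError D α C hM hk).const_mul (1 + C / α))
  rw [mul_zero, mul_zero] at hlim
  refine squeeze_zero_norm' ?_ hlim
  filter_upwards [hM.eventually_ne_atTop 0] with K hK
  have := norm_mean_equation_le (K := K) hD0 hD hK hα hC (hU K)
  push_cast
  exact this

theorem tendsto_mean_sub (hα : 0 < α) {κ δ : ℝ} (hM : Tendsto M atTop atTop)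
    (hk : Tendsto (fun K : ℕ => (K : ℝ) / M K) atTop (nhds κ)) (hδ0 : 0 ≤ δ)
    (hδ : α * δ + κ * (δ / (1 + δ)) = 1)
    {U : ∀ K, Matrix (Fin (M K)) (Fin (M K)) ℂ} (hU : ∀ K, ‖U K‖ ≤ C) :
    Tendsto (fun K => meanResolventTrace K α (U K) - δ * ((M K : ℂ)⁻¹ * trace (U K)))
      atTop (nhds 0) := by
  have hne := hM.eventually_ne_atTop 0
  have hone : ∀ K, ‖(1 : Matrix (Fin (M K)) (Fin (M K)) ℂ)‖ ≤ 1 := fun K => by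
    rw [← diagonal_one, l2_opNorm_diagonal]
    exact (pi_norm_le_iff_of_nonneg zero_le_one).2 fun i => by simp
  have hm1 := tendsto_mean_equation hα le_rfl hM hk hone
  have hm : Tendsto (fun K => meanResolventTrace K α (1 : Matrix (Fin (M K)) (Fin (M K)) ℂ))
      atTop (nhds (δ : ℂ)) := by
    refine tendsto_of_tendsto_fixedPoint_equation hα (fun K => by positivity) hk hδ0 hδ ?_
      (hm1.congr' ?_)
    · filter_upwards [hne] with K hK using re_meanResolventTrace_one_nonneg hK hα
    · filter_upwards [hne] with K hK
      have : (M K : ℂ) ≠ 0 := by exact_mod_cast hK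
      rw [trace_one, Fintype.card_fin, inv_mul_cancel₀ this]
  refine tendsto_sub_of_tendsto_linear_equation (B := max 1 C / α) hk hδ0 hδ hm ?_
    (tendsto_mean_equation hα (le_max_left 1 C) hM hk fun K => (hU K).trans (le_max_right 1 C))
  filter_upwards [hne] with K hK
  exact norm_meanResolventTrace_le hK hα ((hU K).trans (le_max_right 1 C))

theorem ae_tendsto_resolventTrace_sub_mean {Ω : Type*} [MeasurableSpace Ω] {μ : Measure Ω}
    [IsProbabilityMeasure μ] (hα : 0 < α) (hC : 0 < C) (hM : Tendsto M atTop atTop)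
    (hMK : ∀ᶠ K in atTop, (1 / 2 : ℝ) ≤ M K / K)
    {U : ∀ K, Matrix (Fin (M K)) (Fin (M K)) ℂ} (hU : ∀ K, ‖U K‖ ≤ C)
    {Y : ∀ K, Ω → Fin K → Fin (M K) → ℂ} (hY : ∀ K, Measurable (Y K))
    (hlaw : ∀ K, μ.map (Y K) = gaussianRows K (M K)) :
    ∀ᵐ ω ∂μ, Tendsto (fun K => resolventTrace α (U K) (Y K ω) - meanResolventTrace K α (U K))
      atTop (nhds 0) := by
  refine ae_tendsto_zero_of_summable fun ε hε => ?_
  set c : ℝ := ε ^ 2 * α ^ 2 / (128 * C ^ 2) with hc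
  have hc0 : 0 < c := by positivity
  have hsum : Summable fun K : ℕ => 4 * Real.exp (-c * K) := by
    have := (Real.summable_exp_nat_mul_iff.2 (neg_neg_of_pos hc0)).mul_left 4
    simpa only [mul_comm] using this
  refine hsum.of_norm_bounded_eventually_nat ?_
  filter_upwards [hM.eventually_ne_atTop 0, hMK, eventually_ne_atTop 0] with K hK hMK hK0
  rw [Real.norm_of_nonneg measureReal_nonneg]
  refine (measureReal_norm_resolventTrace_sub_mean_ge_le hK hα (hU K) (hY K) (hlaw K) hε).trans ?_
  rw [coe_traceProxy hα hC.le]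
  have hKp : (0 : ℝ) < K := by positivity
  have hMp : (0 : ℝ) < M K := by positivity
  rw [le_div_iff₀ hKp] at hMK
  gcongr
  rw [neg_div, neg_mul, neg_le_neg_iff, le_div_iff₀ (by positivity), hc]
  have hsq : (K : ℝ) ^ 2 ≤ 4 * (M K : ℝ) ^ 2 := by nlinarith
  have hid : ε ^ 2 * α ^ 2 / (128 * C ^ 2) * K * (2 * (K * (2 * C / (α * M K)) ^ 2)) =
      ε ^ 2 * K ^ 2 / (16 * (M K : ℝ) ^ 2) := by
    field_simp
    norm_num
  rw [hid, div_le_iff₀ (by positivity)]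
  nlinarith [mul_le_mul_of_nonneg_left hsq (sq_nonneg ε)]

end AlmostSureLimit

end DeterministicEquivalent

/-- Fundamental deterministic-equivalent theorem for the resolvent
`Q_K = (H_K^H H_K / M + α I_M)⁻¹` of a `K × M` matrix with i.i.d. `CN(0,1)`
entries, in the regime `M/K → β`: for any deterministic matrices `U_M` with
uniformly bounded spectral norm, `(1/M) tr(U Q_K) - (1/M) tr(U Q_o) → 0`
almost surely, where `Q_o = (α + 1/(β(1+δ)))⁻¹ I_M` and `δ` is the unique
nonnegative solution of `δ = 1/(α + 1/(β(1+δ)))`. -/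
theorem stmt2 {Ω : Type*} [MeasurableSpace Ω] (μ : Measure Ω) [IsProbabilityMeasure μ]
    (α β : ℝ) (hα : 0 < α) (hβ : 1 ≤ β)
    (M : ℕ → ℕ) (hM : Tendsto M atTop atTop)
    (hMK : Tendsto (fun K => (M K : ℝ) / K) atTop (nhds β))
    (H : ∀ K : ℕ, Ω → Matrix (Fin K) (Fin (M K)) ℂ)
    (hHmeas : ∀ K, Measurable fun ω (p : Fin K × Fin (M K)) => H K ω p.1 p.2)
    (hHlaw : ∀ K, Measure.map (fun ω (p : Fin K × Fin (M K)) => H K ω p.1 p.2) μ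
      = Measure.pi fun _ : Fin K × Fin (M K) => stdCGaussian)
    (δ : ℝ) (hδ0 : 0 ≤ δ) (hδ : δ = (α + (β * (1 + δ))⁻¹)⁻¹)
    (U : ∀ K : ℕ, Matrix (Fin (M K)) (Fin (M K)) ℂ)
    (hU : ∃ C : ℝ, ∀ K, specNorm (U K) ≤ C) :
    ∀ᵐ ω ∂μ, Tendsto (fun K =>
        (M K : ℂ)⁻¹ * Matrix.trace
            (U K * (((M K : ℂ)⁻¹) • ((H K ω)ᴴ * H K ω) + (α : ℂ) • 1)⁻¹)
          - (M K : ℂ)⁻¹ * Matrix.trace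
            (U K * ((((α + (β * (1 + δ))⁻¹)⁻¹ : ℝ) : ℂ)
              • (1 : Matrix (Fin (M K)) (Fin (M K)) ℂ))))
      atTop (nhds 0) := by
  obtain ⟨C₀, hC₀⟩ := hU
  have hU : ∀ K, Norm.norm (self := Matrix.instL2OpNormedAddCommGroup.toNorm) (U K) ≤ max C₀ 1 :=
    fun K => (hC₀ K).trans (le_max_left _ _)
  have hβ0 : 0 < β := zero_lt_one.trans_le hβ
  have hk : Tendsto (fun K : ℕ => (K : ℝ) / M K) atTop (nhds β⁻¹) := by
    simpa only [inv_div] using hMK.inv₀ hβ0.ne'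
  have hδ1 : α * δ + β⁻¹ * (δ / (1 + δ)) = 1 := by
    have h : δ * (α + (β * (1 + δ))⁻¹) = 1 := by
      nth_rw 1 [hδ]
      exact inv_mul_cancel₀ (by positivity)
    rw [mul_inv] at h
    linear_combination h
  have hcurry : ∀ K, Measurable fun (f : Fin K × Fin (M K) → ℂ) i j => f (i, j) := fun K => by
    fun_prop
  have hlaw : ∀ K, μ.map (fun ω i j => H K ω i j) = gaussianRows K (M K) := fun K => by
    rw [gaussianRows, ← map_curry_pi, ← hHlaw K, Measure.map_map (hcurry K) (hHmeas K)]
    rfl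
  have hfluct := ae_tendsto_resolventTrace_sub_mean (μ := μ) hα
    (lt_max_of_lt_right zero_lt_one : 0 < max C₀ 1) hM
    (hMK.eventually_const_le (by linarith)) hU (fun K => (hcurry K).comp (hHmeas K)) hlaw
  have hmean := tendsto_mean_sub hα hM hk hδ0 hδ1 hU
  filter_upwards [hfluct] with ω hω
  have h := hω.add hmean
  rw [add_zero] at h
  refine h.congr fun K => ?_
  rw [← hδ, mul_smul_comm, mul_one, trace_smul, smul_eq_mul, sub_add_sub_cancel]
  change resolventTrace α (U K) (fun i j => H K ω i j) - _ = _
  rw [mul_left_comm]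
  rfl
end

section
/- For each N ≥ 1, let A_N be a random N×N complex matrix and x_N ∈ ℂ^N a random vector whose entries are i.i.d. complex random variables of zero mean, unit variance, and finite eighth-order moment, with x_N independent of A_N. Assume lim sup_N ‖A_N‖₂ < ∞ almost surely. Then (1/N)·x_N^H A_N x_N − (1/N)·tr(A_N) → 0 almost surely as N → ∞. -/
open MeasureTheory ProbabilityTheory Filter Matrix

section FourthMoment

variable {Ω : Type*} [MeasurableSpace Ω] {μ : Measure Ω}

lemma memLp_four_iff_integrable {f : Ω → ℂ} (hf : AEStronglyMeasurable f μ) :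
    MemLp f 4 μ ↔ Integrable (fun ω => ‖f ω‖ ^ 4) μ := by
  rw [← integrable_norm_rpow_iff hf (by norm_num) (by norm_num)]
  refine integrable_congr (ae_of_all _ fun ω => ?_)
  simp

lemma integrable_norm_pow_four {f : Ω → ℂ} (hf : MemLp f 4 μ) :
    Integrable (fun ω => ‖f ω‖ ^ 4) μ :=
  (memLp_four_iff_integrable hf.aestronglyMeasurable).1 hf

lemma memLp_two_norm_sq {f : Ω → ℂ} (hf : MemLp f 4 μ) :
    MemLp (fun ω => ‖f ω‖ ^ 2) 2 μ := by
  refine (memLp_two_iff_integrable_sq (hf.aestronglyMeasurable.norm.pow 2)).2 ?_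
  simpa only [Pi.pow_apply, ← pow_mul] using integrable_norm_pow_four hf

/-- The Cauchy-Schwarz inequality for the squares of two functions in `L⁴`. -/
lemma integral_norm_sq_mul_norm_sq_le {f g : Ω → ℂ} (hf : MemLp f 4 μ) (hg : MemLp g 4 μ) :
    ∫ ω, ‖f ω‖ ^ 2 * ‖g ω‖ ^ 2 ∂μ ≤ √(∫ ω, ‖f ω‖ ^ 4 ∂μ) * √(∫ ω, ‖g ω‖ ^ 4 ∂μ) := by
  have h := integral_mul_le_Lp_mul_Lq_of_nonneg (μ := μ) (p := 2) (q := 2)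
    Real.HolderConjugate.two_two (f := fun ω => ‖f ω‖ ^ 2) (g := fun ω => ‖g ω‖ ^ 2)
    (ae_of_all _ fun ω => by positivity) (ae_of_all _ fun ω => by positivity)
    (by simpa using memLp_two_norm_sq hf) (by simpa using memLp_two_norm_sq hg)
  simpa only [Real.rpow_two, ← pow_mul, ← Real.sqrt_eq_rpow] using h

/-- A fourth power of a sum expanded to first order, with a quadratic remainder. -/
lemma norm_add_pow_four_le (a b : ℂ) :
    ‖a + b‖ ^ 4 ≤ ‖a‖ ^ 4 + 4 * ((‖a‖ ^ 2 : ℝ) * star a * b).re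
      + 8 * (‖a‖ ^ 2 * ‖b‖ ^ 2) + 3 * ‖b‖ ^ 4 := by
  have hre : ((‖a‖ ^ 2 : ℝ) * star a * b).re = ‖a‖ ^ 2 * (star a * b).re := by
    rw [mul_assoc, Complex.re_ofReal_mul]
  have hsq : ‖a + b‖ ^ 2 = ‖a‖ ^ 2 + 2 * (star a * b).re + ‖b‖ ^ 2 := by
    simp only [Complex.sq_norm, Complex.normSq_apply]
    simp
    ring
  have habs : |(star a * b).re| ≤ ‖a‖ * ‖b‖ := by
    simpa using Complex.abs_re_le_norm (star a * b)
  rw [hre, show ‖a + b‖ ^ 4 = (‖a + b‖ ^ 2) ^ 2 by ring, hsq]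
  generalize (star a * b).re = r at *
  have hr := abs_le.1 habs
  have hr2 : r ^ 2 ≤ ‖a‖ ^ 2 * ‖b‖ ^ 2 := by
    rw [← mul_pow]; exact sq_le_sq' hr.1 hr.2
  nlinarith [mul_le_mul_of_nonneg_right hr.2 (sq_nonneg ‖b‖),
    mul_nonneg (sq_nonneg ‖b‖) (sq_nonneg (‖a‖ - ‖b‖))]

lemma integrable_norm_sq_mul_star_mul {f g : Ω → ℂ} (hf : MemLp f 4 μ) (hg : MemLp g 4 μ) :
    Integrable (fun ω => ((‖f ω‖ ^ 2 : ℝ) : ℂ) * star (f ω) * g ω) μ := by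
  have hfm := hf.aestronglyMeasurable
  have hgm := hg.aestronglyMeasurable
  refine Integrable.mono' ((integrable_norm_pow_four hf).add
    (integrable_norm_pow_four hg)) ?_ (ae_of_all _ fun ω => ?_)
  · exact ((Complex.continuous_ofReal.comp_aestronglyMeasurable (hfm.norm.pow 2)).mul
      hfm.star).mul hgm
  · have h : ‖((‖f ω‖ ^ 2 : ℝ) : ℂ) * star (f ω) * g ω‖ = ‖f ω‖ ^ 3 * ‖g ω‖ := by
      simp only [norm_mul, Complex.norm_real, norm_star, norm_pow, norm_norm]
      ring
    rw [h]
    simp only [Pi.add_apply]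
    have ha := norm_nonneg (f ω)
    have hb := norm_nonneg (g ω)
    rcases le_total ‖f ω‖ ‖g ω‖ with hab | hab
    · have : ‖f ω‖ ^ 3 * ‖g ω‖ ≤ ‖g ω‖ ^ 3 * ‖g ω‖ := by gcongr
      nlinarith [pow_nonneg ha 4]
    · have : ‖f ω‖ ^ 3 * ‖g ω‖ ≤ ‖f ω‖ ^ 3 * ‖f ω‖ := by gcongr
      nlinarith [pow_nonneg hb 4]

/-- Adding a term orthogonal to `‖M‖² M` increases the squared `L⁴` norm by at most four times
the squared `L⁴` norm of that term. -/
lemma sqrt_integral_norm_add_pow_four_le {M D : Ω → ℂ} (hM : MemLp M 4 μ) (hD : MemLp D 4 μ)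
    (horth : ∫ ω, ((‖M ω‖ ^ 2 : ℝ) : ℂ) * star (M ω) * D ω ∂μ = 0) :
    √(∫ ω, ‖M ω + D ω‖ ^ 4 ∂μ) ≤ √(∫ ω, ‖M ω‖ ^ 4 ∂μ) + 4 * √(∫ ω, ‖D ω‖ ^ 4 ∂μ) := by
  have hiM := integrable_norm_pow_four hM
  have hiD := integrable_norm_pow_four hD
  have hiO := integrable_norm_sq_mul_star_mul hM hD
  have hiP : Integrable (fun ω => ‖M ω‖ ^ 2 * ‖D ω‖ ^ 2) μ :=
    (memLp_two_norm_sq hM).integrable_mul (memLp_two_norm_sq hD)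
  have hre : ∫ ω, (((‖M ω‖ ^ 2 : ℝ) : ℂ) * star (M ω) * D ω).re ∂μ = 0 :=
    (integral_re hiO).trans (by rw [horth]; rfl)
  have hle : ∫ ω, ‖M ω + D ω‖ ^ 4 ∂μ ≤ ∫ ω, ‖M ω‖ ^ 4 ∂μ
      + 8 * ∫ ω, ‖M ω‖ ^ 2 * ‖D ω‖ ^ 2 ∂μ + 3 * ∫ ω, ‖D ω‖ ^ 4 ∂μ := by
    have hiR : Integrable (fun ω => (((‖M ω‖ ^ 2 : ℝ) : ℂ) * star (M ω) * D ω).re) μ := hiO.re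
    have hi₁ : Integrable (fun ω => ‖M ω‖ ^ 4
        + 4 * (((‖M ω‖ ^ 2 : ℝ) : ℂ) * star (M ω) * D ω).re) μ := hiM.add (hiR.const_mul 4)
    have hi₂ : Integrable (fun ω => ‖M ω‖ ^ 4
        + 4 * (((‖M ω‖ ^ 2 : ℝ) : ℂ) * star (M ω) * D ω).re
        + 8 * (‖M ω‖ ^ 2 * ‖D ω‖ ^ 2)) μ := hi₁.add (hiP.const_mul 8)
    refine (integral_mono (integrable_norm_pow_four (hM.add hD)) (hi₂.add (hiD.const_mul 3))
      fun ω => norm_add_pow_four_le _ _).trans_eq ?_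
    simp only [Pi.add_apply]
    rw [integral_add hi₂ (hiD.const_mul 3), integral_add hi₁ (hiP.const_mul 8),
      integral_add hiM (hiR.const_mul 4)]
    simp only [integral_const_mul, hre, mul_zero, add_zero]
  have hCS := integral_norm_sq_mul_norm_sq_le hM hD
  have hm := Real.sq_sqrt (integral_nonneg fun ω => pow_nonneg (norm_nonneg (M ω)) 4 :
    0 ≤ ∫ ω, ‖M ω‖ ^ 4 ∂μ)
  have hd := Real.sq_sqrt (integral_nonneg fun ω => pow_nonneg (norm_nonneg (D ω)) 4 :
    0 ≤ ∫ ω, ‖D ω‖ ^ 4 ∂μ)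
  apply Real.sqrt_le_iff.2 ⟨by positivity, ?_⟩
  nlinarith [sq_nonneg √(∫ ω, ‖D ω‖ ^ 4 ∂μ)]

lemma memLp_four_mul_of_indepFun {f g : Ω → ℂ} (h : IndepFun f g μ)
    (hf : MemLp f 4 μ) (hg : MemLp g 4 μ) : MemLp (fun ω => f ω * g ω) 4 μ := by
  refine (memLp_four_iff_integrable
    (hf.aestronglyMeasurable.mul hg.aestronglyMeasurable)).2 ?_
  have hn : IndepFun (fun ω => ‖f ω‖ ^ 4) (fun ω => ‖g ω‖ ^ 4) μ :=
    h.comp (φ := fun z : ℂ => ‖z‖ ^ 4) (ψ := fun z : ℂ => ‖z‖ ^ 4) (by fun_prop) (by fun_prop)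
  simpa only [Pi.mul_def, norm_mul, mul_pow] using hn.integrable_mul (integrable_norm_pow_four hf)
    (integrable_norm_pow_four hg)

lemma integral_norm_mul_pow_four_of_indepFun {f g : Ω → ℂ} (h : IndepFun f g μ)
    (hf : MemLp f 4 μ) (hg : MemLp g 4 μ) :
    ∫ ω, ‖f ω * g ω‖ ^ 4 ∂μ = (∫ ω, ‖f ω‖ ^ 4 ∂μ) * ∫ ω, ‖g ω‖ ^ 4 ∂μ := by
  have hn : IndepFun (fun ω => ‖f ω‖ ^ 4) (fun ω => ‖g ω‖ ^ 4) μ :=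
    h.comp (φ := fun z : ℂ => ‖z‖ ^ 4) (ψ := fun z : ℂ => ‖z‖ ^ 4) (by fun_prop) (by fun_prop)
  simpa only [norm_mul, mul_pow] using hn.integral_fun_mul_eq_mul_integral
    (hf.aestronglyMeasurable.norm.pow 4) (hg.aestronglyMeasurable.norm.pow 4)

lemma integral_add_three {E : Type*} [NormedAddCommGroup E] [NormedSpace ℝ E] {f g h : Ω → E}
    (hf : Integrable f μ) (hg : Integrable g μ) (hh : Integrable h μ) :
    ∫ ω, (f ω + g ω + h ω) ∂μ = ∫ ω, f ω ∂μ + ∫ ω, g ω ∂μ + ∫ ω, h ω ∂μ := by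
  rw [integral_add (f := fun ω => f ω + g ω) (hf.add hg) hh, integral_add hf hg]

end FourthMoment

/-- The centred quadratic form restricted to the coordinates in `s`. -/
def centredQuadForm {ι : Type*} (A : Matrix ι ι ℂ) (s : Finset ι) (v : ι → ℂ) : ℂ :=
  ∑ i ∈ s, ∑ j ∈ s, star (v i) * A i j * v j - ∑ i ∈ s, A i i

lemma centredQuadForm_insert {ι : Type*} [DecidableEq ι] (A : Matrix ι ι ℂ) {s : Finset ι} {k : ι}
    (hk : k ∉ s) (v : ι → ℂ) :
    centredQuadForm A (insert k s) v = centredQuadForm A s v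
      + (A k k * ((‖v k‖ ^ 2 : ℝ) - 1) + (∑ j ∈ s, A k j * v j) * star (v k)
        + star (∑ i ∈ s, star (A i k) * v i) * v k) := by
  have hsq : star (v k) * v k = ((‖v k‖ ^ 2 : ℝ) : ℂ) := by
    simpa using Complex.conj_mul' (v k)
  have hL : ∑ j ∈ s, star (v k) * A k j * v j = (∑ j ∈ s, A k j * v j) * star (v k) := by
    rw [Finset.sum_mul]
    exact Finset.sum_congr rfl fun j _ => by ring
  have hR : ∑ i ∈ s, star (v i) * A i k * v k = star (∑ i ∈ s, star (A i k) * v i) * v k := by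
    rw [star_sum, Finset.sum_mul]
    exact Finset.sum_congr rfl fun i _ => by rw [star_mul, star_star]
  simp only [centredQuadForm, Finset.sum_insert hk, Finset.sum_add_distrib, hL, hR]
  linear_combination A k k * hsq

lemma norm_add_three_pow_four_le (a b c : ℂ) :
    ‖a + b + c‖ ^ 4 ≤ 27 * (‖a‖ ^ 4 + ‖b‖ ^ 4 + ‖c‖ ^ 4) := by
  have h : ‖a + b + c‖ ≤ ‖a‖ + ‖b‖ + ‖c‖ := norm_add₃_le
  have h2 (x y z : ℝ) : (x + y + z) ^ 2 ≤ 3 * (x ^ 2 + y ^ 2 + z ^ 2) := by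
    nlinarith [sq_nonneg (x - y), sq_nonneg (y - z), sq_nonneg (x - z)]
  calc ‖a + b + c‖ ^ 4 ≤ (‖a‖ + ‖b‖ + ‖c‖) ^ 4 := by gcongr
    _ = ((‖a‖ + ‖b‖ + ‖c‖) ^ 2) ^ 2 := by ring
    _ ≤ (3 * (‖a‖ ^ 2 + ‖b‖ ^ 2 + ‖c‖ ^ 2)) ^ 2 := by gcongr; exact h2 _ _ _
    _ ≤ _ := by nlinarith [h2 (‖a‖ ^ 2) (‖b‖ ^ 2) (‖c‖ ^ 2)]

section ProductMeasure

variable {ι : Type*} [Fintype ι] {ν : Measure ℂ} [IsProbabilityMeasure ν]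

/-- Under a product measure, a coordinate is independent of any function of other coordinates. -/
lemma indepFun_eval_of_notMem {s : Finset ι} {k : ι} (hk : k ∉ s) {φ : (ι → ℂ) → ℂ}
    (hφ : Measurable φ) (hs : ∀ v w : ι → ℂ, (∀ j ∈ s, v j = w j) → φ v = φ w) :
    IndepFun (fun v : ι → ℂ => v k) φ (Measure.pi fun _ => ν) := by
  classical
  have hind : iIndepFun (fun i (v : ι → ℂ) => v i) (Measure.pi fun _ => ν) :=
    iIndepFun_pi (X := fun _ => id) fun _ => aemeasurable_id
  have h := hind.indepFun_finset {k} s (by simpa using hk) fun i => measurable_pi_apply i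
  have hext : Measurable fun (v : s → ℂ) (i : ι) => if h : i ∈ s then v ⟨i, h⟩ else 0 := by
    refine measurable_pi_lambda _ fun i => ?_
    by_cases hi : i ∈ s
    · simpa [hi] using measurable_pi_apply _
    · simp [hi]
  have hev : Measurable fun v : ({k} : Finset ι) → ℂ => v ⟨k, Finset.mem_singleton_self k⟩ :=
    measurable_pi_apply _
  have hc := h.comp hev (hφ.comp hext)
  exact hc.congr (ae_of_all _ fun v => rfl)
    (ae_of_all _ fun v => hs _ _ fun j hj => by simp [hj])

lemma integral_mul_comp_eval_eq_zero {s : Finset ι} {k : ι} (hk : k ∉ s) {φ : (ι → ℂ) → ℂ}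
    (hφ : Measurable φ) (hs : ∀ v w : ι → ℂ, (∀ j ∈ s, v j = w j) → φ v = φ w)
    {g : ℂ → ℂ} (hg : Measurable g) (hg0 : ∫ z, g z ∂ν = 0) :
    ∫ v, φ v * g (v k) ∂(Measure.pi fun _ : ι => ν) = 0 := by
  have h := (indepFun_eval_of_notMem (ν := ν) hk hφ hs).symm.comp measurable_id hg
  have h' := h.integral_fun_mul_eq_mul_integral hφ.aestronglyMeasurable
    (hg.comp (measurable_pi_apply k)).aestronglyMeasurable
  simp only [Function.comp_def, id] at h'
  rw [h', integral_comp_eval (μ := fun _ : ι => ν) hg.aestronglyMeasurable, hg0, mul_zero]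

lemma memLp_comp_eval {g : ℂ → ℂ} {p : ENNReal} (hg : MemLp g p ν) (k : ι) :
    MemLp (fun v : ι → ℂ => g (v k)) p (Measure.pi fun _ => ν) :=
  hg.comp_measurePreserving (measurePreserving_eval (fun _ : ι => ν) k)

lemma integral_norm_eval_pow_four (k : ι) {g : ℂ → ℂ} (hg : Measurable g) :
    ∫ v, ‖g (v k)‖ ^ 4 ∂(Measure.pi fun _ : ι => ν) = ∫ z, ‖g z‖ ^ 4 ∂ν :=
  integral_comp_eval (μ := fun _ : ι => ν) (f := fun z => ‖g z‖ ^ 4)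
    (by fun_prop : Measurable fun z => ‖g z‖ ^ 4).aestronglyMeasurable

/-- Fourth moment bound for linear forms in independent centred variables. -/
lemma linearForm_fourth_moment (hmean : ∫ z, z ∂ν = 0) (h4 : MemLp (fun z : ℂ => z) 4 ν)
    (a : ι → ℂ) (s : Finset ι) :
    MemLp (fun v : ι → ℂ => ∑ j ∈ s, a j * v j) 4 (Measure.pi fun _ => ν) ∧
    √(∫ v, ‖∑ j ∈ s, a j * v j‖ ^ 4 ∂(Measure.pi fun _ : ι => ν))
      ≤ 4 * √(∫ z, ‖z‖ ^ 4 ∂ν) * ∑ j ∈ s, ‖a j‖ ^ 2 := by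
  classical
  induction s using Finset.induction_on with
  | empty => simp
  | insert k s hk ih =>
    obtain ⟨ihM, ihle⟩ := ih
    have hD : MemLp (fun v : ι → ℂ => a k * v k) 4 (Measure.pi fun _ => ν) :=
      (memLp_comp_eval h4 k).const_mul (a k)
    have horth : ∫ v : ι → ℂ, ((‖∑ j ∈ s, a j * v j‖ ^ 2 : ℝ) : ℂ)
        * star (∑ j ∈ s, a j * v j) * (a k * v k) ∂(Measure.pi fun _ => ν) = 0 := by
      simp only [← mul_assoc]
      refine integral_mul_comp_eval_eq_zero hk (g := fun z => z)
        (φ := fun v => ((‖∑ j ∈ s, a j * v j‖ ^ 2 : ℝ) : ℂ) * star (∑ j ∈ s, a j * v j) * a k)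
        (by fun_prop) (fun v w h => ?_) measurable_id hmean
      have hsum : ∑ j ∈ s, a j * v j = ∑ j ∈ s, a j * w j :=
        Finset.sum_congr rfl fun j hj => by rw [h j hj]
      simp only [hsum]
    have hnorm : √(∫ v, ‖a k * v k‖ ^ 4 ∂(Measure.pi fun _ : ι => ν))
        = √(∫ z, ‖z‖ ^ 4 ∂ν) * ‖a k‖ ^ 2 := by
      simp only [norm_mul, mul_pow, integral_const_mul]
      rw [integral_norm_eval_pow_four k (g := fun z => z) measurable_id, mul_comm,
        Real.sqrt_mul (integral_nonneg fun z => by positivity),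
        show ‖a k‖ ^ 4 = (‖a k‖ ^ 2) ^ 2 by ring, Real.sqrt_sq (by positivity)]
    have hstep := sqrt_integral_norm_add_pow_four_le ihM hD horth
    simp only [Finset.sum_insert hk, add_comm (a k * _)]
    refine ⟨ihM.add hD, hstep.trans ?_⟩
    rw [hnorm]
    linarith

/-- Fourth moment bound for centred quadratic forms in i.i.d. centred variables of unit
variance, for a matrix whose rows and columns have squared Euclidean norm at most `b`. -/
lemma centredQuadForm_fourth_moment (hmean : ∫ z, z ∂ν = 0) (hvar : ∫ z, ‖z‖ ^ 2 ∂ν = 1)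
    (h4 : MemLp (fun z : ℂ => z) 4 ν)
    (h4' : MemLp (fun z : ℂ => ((‖z‖ ^ 2 : ℝ) : ℂ) - 1) 4 ν)
    {A : Matrix ι ι ℂ} {b : ℝ} (hrow : ∀ i, ∑ j, ‖A i j‖ ^ 2 ≤ b)
    (hcol : ∀ j, ∑ i, ‖A i j‖ ^ 2 ≤ b) (s : Finset ι) :
    MemLp (centredQuadForm A s) 4 (Measure.pi fun _ => ν) ∧
    √(∫ v, ‖centredQuadForm A s v‖ ^ 4 ∂(Measure.pi fun _ : ι => ν))
      ≤ 4 * √(27 * (∫ z, ‖((‖z‖ ^ 2 : ℝ) : ℂ) - 1‖ ^ 4 ∂ν + 32 * (∫ z, ‖z‖ ^ 4 ∂ν) ^ 2))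
        * b * s.card := by
  classical
  set m := ∫ z, ‖z‖ ^ 4 ∂ν with hm
  set c := ∫ z, ‖((‖z‖ ^ 2 : ℝ) : ℂ) - 1‖ ^ 4 ∂ν with hc
  have hm0 : 0 ≤ m := integral_nonneg fun z => by positivity
  have hc0 : 0 ≤ c := integral_nonneg fun z => by positivity
  induction s using Finset.induction_on with
  | empty =>
    have h0 : centredQuadForm A ∅ = fun _ => 0 := by
      funext v
      simp [centredQuadForm]
    simp [h0]
  | insert k s hk ih =>
    obtain ⟨ihM, ihle⟩ := ih
    have hb0 : 0 ≤ b := (Finset.sum_nonneg fun j _ => by positivity).trans (hrow k)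
    have hform (a : ι → ℂ) (ha : ∑ j, ‖a j‖ ^ 2 ≤ b) :
        MemLp (fun v : ι → ℂ => ∑ j ∈ s, a j * v j) 4 (Measure.pi fun _ => ν) ∧
        ∫ v, ‖∑ j ∈ s, a j * v j‖ ^ 4 ∂(Measure.pi fun _ : ι => ν) ≤ 16 * m * b ^ 2 := by
      obtain ⟨h1, h2⟩ := linearForm_fourth_moment hmean h4 a s
      refine ⟨h1, ?_⟩
      have h3 : ∑ j ∈ s, ‖a j‖ ^ 2 ≤ b :=
        (Finset.sum_le_univ_sum_of_nonneg fun j => by positivity).trans ha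
      have h5 := (Real.sqrt_le_iff.1 (h2.trans (mul_le_mul_of_nonneg_left h3 (by positivity)))).2
      calc _ ≤ _ := h5
        _ = _ := by rw [mul_pow, mul_pow, Real.sq_sqrt hm0]; norm_num
    obtain ⟨hL, hLle⟩ := hform (fun j => A k j) (hrow k)
    obtain ⟨hR, hRle⟩ := hform (fun i => star (A i k)) (by simpa using hcol k)
    have hsR := hR.star
    have hform_congr (a : ι → ℂ) (v w : ι → ℂ) (h : ∀ j ∈ s, v j = w j) :
        ∑ j ∈ s, a j * v j = ∑ j ∈ s, a j * w j :=
      Finset.sum_congr rfl fun j hj => by rw [h j hj]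
    have hQ_congr (v w : ι → ℂ) (h : ∀ j ∈ s, v j = w j) :
        centredQuadForm A s v = centredQuadForm A s w := by
      simp only [centredQuadForm]
      congr 1
      exact Finset.sum_congr rfl fun i hi => Finset.sum_congr rfl fun j hj => by
        rw [h i hi, h j hj]
    have hQ_meas : Measurable (centredQuadForm A s) := by
      unfold centredQuadForm
      fun_prop
    have hstar4 : MemLp (fun z : ℂ => star z) 4 ν := h4.star
    have hindL : IndepFun (fun v : ι → ℂ => ∑ j ∈ s, A k j * v j) (fun v => star (v k))
        (Measure.pi fun _ => ν) :=
      (indepFun_eval_of_notMem hk (φ := fun v => ∑ j ∈ s, A k j * v j) (by fun_prop)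
        (hform_congr _)).symm.comp measurable_id continuous_star.measurable
    have hindR : IndepFun (fun v : ι → ℂ => star (∑ i ∈ s, star (A i k) * v i)) (fun v => v k)
        (Measure.pi fun _ => ν) :=
      (indepFun_eval_of_notMem hk (φ := fun v => ∑ i ∈ s, star (A i k) * v i) (by fun_prop)
        (hform_congr _)).symm.comp continuous_star.measurable measurable_id
    have hT₁ : MemLp (fun v : ι → ℂ => A k k * (((‖v k‖ ^ 2 : ℝ) : ℂ) - 1)) 4
        (Measure.pi fun _ => ν) := (memLp_comp_eval h4' k).const_mul (A k k)
    have hT₂ := memLp_four_mul_of_indepFun hindL hL (memLp_comp_eval hstar4 k)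
    have hT₃ := memLp_four_mul_of_indepFun hindR hsR (memLp_comp_eval h4 k)
    have hI₂ := integral_norm_mul_pow_four_of_indepFun hindL hL (memLp_comp_eval hstar4 k)
    have hI₃ := integral_norm_mul_pow_four_of_indepFun hindR hsR (memLp_comp_eval h4 k)
    have hAkk : ‖A k k‖ ^ 4 ≤ b ^ 2 := by
      rw [show ‖A k k‖ ^ 4 = (‖A k k‖ ^ 2) ^ 2 by ring]
      gcongr
      exact (Finset.single_le_sum (f := fun j => ‖A k j‖ ^ 2) (fun j _ => by positivity)
        (Finset.mem_univ k)).trans (hrow k)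
    have hI₁ : ∫ v, ‖A k k * (((‖v k‖ ^ 2 : ℝ) : ℂ) - 1)‖ ^ 4 ∂(Measure.pi fun _ : ι => ν)
        = ‖A k k‖ ^ 4 * c := by
      simp only [norm_mul, mul_pow, integral_const_mul]
      rw [integral_norm_eval_pow_four k (g := fun z => ((‖z‖ ^ 2 : ℝ) : ℂ) - 1) (by fun_prop)]
    simp only [norm_star] at hI₂ hI₃
    rw [integral_norm_eval_pow_four k (g := fun z => z) measurable_id, ← hm] at hI₂ hI₃
    have hD : MemLp (fun v : ι → ℂ => A k k * (((‖v k‖ ^ 2 : ℝ) : ℂ) - 1)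
        + (∑ j ∈ s, A k j * v j) * star (v k)
        + star (∑ i ∈ s, star (A i k) * v i) * v k) 4 (Measure.pi fun _ => ν) :=
      (hT₁.add hT₂).add hT₃
    have hDle : √(∫ v : ι → ℂ, ‖A k k * (((‖v k‖ ^ 2 : ℝ) : ℂ) - 1)
        + (∑ j ∈ s, A k j * v j) * star (v k)
        + star (∑ i ∈ s, star (A i k) * v i) * v k‖ ^ 4 ∂(Measure.pi fun _ => ν))
        ≤ √(27 * (c + 32 * m ^ 2)) * b := by
      have hi₁ := integrable_norm_pow_four hT₁
      have hi₂ := integrable_norm_pow_four hT₂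
      have hi₃ := integrable_norm_pow_four hT₃
      have hle := integral_mono (integrable_norm_pow_four hD)
        (((hi₁.add hi₂).add hi₃).const_mul 27) fun v => norm_add_three_pow_four_le _ _ _
      simp only [Pi.add_apply] at hle
      rw [integral_const_mul, integral_add_three hi₁ hi₂ hi₃, hI₁, hI₂, hI₃] at hle
      rw [← Real.sqrt_sq hb0, ← Real.sqrt_mul (by positivity)]
      refine Real.sqrt_le_sqrt (hle.trans ?_)
      nlinarith [mul_le_mul_of_nonneg_right hAkk hc0, mul_le_mul_of_nonneg_right hLle hm0,
        mul_le_mul_of_nonneg_right hRle hm0]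
    have horth : ∫ v : ι → ℂ, ((‖centredQuadForm A s v‖ ^ 2 : ℝ) : ℂ)
        * star (centredQuadForm A s v) * (A k k * (((‖v k‖ ^ 2 : ℝ) : ℂ) - 1)
        + (∑ j ∈ s, A k j * v j) * star (v k)
        + star (∑ i ∈ s, star (A i k) * v i) * v k) ∂(Measure.pi fun _ => ν) = 0 := by
      have hvar0 : ∫ z, (((‖z‖ ^ 2 : ℝ) : ℂ) - 1) ∂ν = 0 := by
        have hi : Integrable (fun z : ℂ => ‖z‖ ^ 2) ν :=
          Integrable.of_integral_ne_zero (by rw [hvar]; exact one_ne_zero)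
        rw [integral_sub hi.ofReal (integrable_const _), integral_complex_ofReal, hvar]
        simp
      have hstar0 : ∫ z, star z ∂ν = 0 := by
        simpa [hmean] using integral_conj (μ := ν) (f := fun z : ℂ => z)
      have ho₁ := integrable_norm_sq_mul_star_mul ihM hT₁
      have ho₂ := integrable_norm_sq_mul_star_mul ihM hT₂
      have ho₃ := integrable_norm_sq_mul_star_mul ihM hT₃
      simp only [mul_add]
      rw [integral_add_three ho₁ ho₂ ho₃]
      simp only [← mul_assoc]
      rw [integral_mul_comp_eval_eq_zero hk (g := fun z => ((‖z‖ ^ 2 : ℝ) : ℂ) - 1)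
          (φ := fun v => ((‖centredQuadForm A s v‖ ^ 2 : ℝ) : ℂ)
            * star (centredQuadForm A s v) * A k k) (by fun_prop)
          (fun v w h => by simp only [hQ_congr v w h]) (by fun_prop) hvar0,
        integral_mul_comp_eval_eq_zero hk (g := fun z => star z)
          (φ := fun v => ((‖centredQuadForm A s v‖ ^ 2 : ℝ) : ℂ)
            * star (centredQuadForm A s v) * ∑ j ∈ s, A k j * v j) (by fun_prop)
          (fun v w h => by simp only [hQ_congr v w h, hform_congr _ v w h]) (by fun_prop) hstar0,
        integral_mul_comp_eval_eq_zero hk (g := fun z => z)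
          (φ := fun v => ((‖centredQuadForm A s v‖ ^ 2 : ℝ) : ℂ)
            * star (centredQuadForm A s v) * star (∑ i ∈ s, star (A i k) * v i)) (by fun_prop)
          (fun v w h => by simp only [hQ_congr v w h, hform_congr _ v w h]) (by fun_prop) hmean]
      simp
    have hstep := sqrt_integral_norm_add_pow_four_le ihM hD horth
    have heq : centredQuadForm A (insert k s) = fun v => centredQuadForm A s v
      + (A k k * ((‖v k‖ ^ 2 : ℝ) - 1) + (∑ j ∈ s, A k j * v j) * star (v k)
        + star (∑ i ∈ s, star (A i k) * v i) * v k) := funext (centredQuadForm_insert A hk)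
    rw [heq]
    refine ⟨ihM.add hD, hstep.trans ((add_le_add ihle
      (mul_le_mul_of_nonneg_left hDle zero_le_four)).trans_eq ?_)⟩
    rw [Finset.card_insert_of_notMem hk]
    push_cast
    ring

end ProductMeasure

section SpectralNorm

variable {m n : Type*} [Fintype m] [Fintype n] [DecidableEq n]

lemma specNorm_nonneg (A : Matrix m n ℂ) : 0 ≤ specNorm A := norm_nonneg _

lemma specNorm_conjTranspose [DecidableEq m] (A : Matrix m n ℂ) : specNorm Aᴴ = specNorm A :=
  Matrix.l2_opNorm_conjTranspose A

lemma sum_norm_sq_col_le_specNorm_sq (A : Matrix m n ℂ) (j : n) :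
    ∑ i, ‖A i j‖ ^ 2 ≤ specNorm A ^ 2 := by
  have h := (LinearMap.toContinuousLinearMap (Matrix.toEuclideanLin A)).le_opNorm
    (EuclideanSpace.single j 1)
  rw [PiLp.norm_single, norm_one, mul_one] at h
  have hcol : ‖LinearMap.toContinuousLinearMap (Matrix.toEuclideanLin A)
      (EuclideanSpace.single j 1)‖ ^ 2 = ∑ i, ‖A i j‖ ^ 2 := by
    rw [EuclideanSpace.norm_sq_eq]
    simp [Matrix.toLpLin_apply]
  rw [← hcol]
  exact pow_le_pow_left₀ (norm_nonneg _) h 2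

lemma sum_norm_sq_row_le_specNorm_sq [DecidableEq m] (A : Matrix m n ℂ) (i : m) :
    ∑ j, ‖A i j‖ ^ 2 ≤ specNorm A ^ 2 := by
  simpa [specNorm_conjTranspose] using sum_norm_sq_col_le_specNorm_sq Aᴴ i

lemma measurable_specNorm_of :
    Measurable fun a : m × n → ℂ => specNorm (Matrix.of fun i j => a (i, j)) := by
  let L : (m × n → ℂ) →ₗ[ℂ] EuclideanSpace ℂ n →L[ℂ] EuclideanSpace ℂ m :=
    { toFun := fun a => LinearMap.toContinuousLinearMap
        (Matrix.toEuclideanLin (Matrix.of fun i j => a (i, j)))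
      map_add' := fun a b => by
        rw [← map_add, ← map_add]
        rfl
      map_smul' := fun c a => by
        rw [RingHom.id_apply, ← map_smul, ← map_smul]
        rfl }
  exact (LinearMap.continuous_of_finiteDimensional L).norm.measurable

end SpectralNorm

lemma memLp_four_of_integrable_norm_pow_eight {ν : Measure ℂ} [IsProbabilityMeasure ν]
    (h8 : Integrable (fun z : ℂ => ‖z‖ ^ 8) ν) :
    MemLp (fun z : ℂ => z) 4 ν ∧ MemLp (fun z : ℂ => ((‖z‖ ^ 2 : ℝ) : ℂ) - 1) 4 ν := by
  constructor
  · exact (memLp_four_iff_integrable measurable_id.aestronglyMeasurable).2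
      (integrable_norm_pow_of_le measurable_id.aestronglyMeasurable (by norm_num) h8)
  · refine MemLp.sub ((memLp_four_iff_integrable
      (by fun_prop : Measurable fun z : ℂ => ((‖z‖ ^ 2 : ℝ) : ℂ)).aestronglyMeasurable).2 ?_)
      (memLp_const 1)
    simpa [← pow_mul] using h8

lemma lintegral_pi_weighted_centredQuadForm_le {ν : Measure ℂ} [IsProbabilityMeasure ν]
    (hmean : ∫ z, z ∂ν = 0) (hvar : ∫ z, ‖z‖ ^ 2 ∂ν = 1)
    (hmom8 : Integrable (fun z : ℂ => ‖z‖ ^ 8) ν) {N : ℕ} (B : Matrix (Fin N) (Fin N) ℂ) :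
    ∫⁻ v, ENNReal.ofReal
      (‖centredQuadForm B Finset.univ v‖ ^ 4 / ((1 + specNorm B ^ 2) ^ 2 * N ^ 4))
        ∂(Measure.pi fun _ : Fin N => ν)
      ≤ ENNReal.ofReal ((4 * √(27 * (∫ z, ‖((‖z‖ ^ 2 : ℝ) : ℂ) - 1‖ ^ 4 ∂ν
        + 32 * (∫ z, ‖z‖ ^ 4 ∂ν) ^ 2))) ^ 2 * (1 / (N : ℝ) ^ 2)) := by
  set K := 4 * √(27 * (∫ z, ‖((‖z‖ ^ 2 : ℝ) : ℂ) - 1‖ ^ 4 ∂ν + 32 * (∫ z, ‖z‖ ^ 4 ∂ν) ^ 2))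
  obtain ⟨h4, h4'⟩ := memLp_four_of_integrable_norm_pow_eight hmom8
  obtain ⟨hmem, hle⟩ := centredQuadForm_fourth_moment hmean hvar h4 h4'
    (sum_norm_sq_row_le_specNorm_sq B)
    (sum_norm_sq_col_le_specNorm_sq B) Finset.univ
  have hle' := (Real.sqrt_le_iff.1 hle).2
  rw [Finset.card_univ, Fintype.card_fin] at hle'
  rw [← ofReal_integral_eq_lintegral_ofReal
    ((integrable_norm_pow_four hmem).div_const _) (ae_of_all _ fun v => by positivity)]
  refine ENNReal.ofReal_le_ofReal ?_
  rw [integral_div]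
  have hS0 : 0 ≤ specNorm B ^ 2 := sq_nonneg _
  rcases Nat.eq_zero_or_pos N with hN | hN
  · subst hN
    simp
  have hN' : (0 : ℝ) < N := Nat.cast_pos.2 hN
  rw [div_le_iff₀ (by positivity)]
  refine hle'.trans ?_
  have hcancel : K ^ 2 * (1 / (N : ℝ) ^ 2) * ((1 + specNorm B ^ 2) ^ 2 * N ^ 4)
      = (K * (1 + specNorm B ^ 2) * N) ^ 2 := by
    field_simp
  rw [hcancel]
  have hK : 0 ≤ K := by positivity
  change (K * specNorm B ^ 2 * N) ^ 2 ≤ _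
  gcongr
  linarith

lemma measurable_weighted_centredQuadForm (N : ℕ) :
    Measurable fun p : (Fin N → ℂ) × (Fin N × Fin N → ℂ) => ENNReal.ofReal
      (‖centredQuadForm (Matrix.of fun i j => p.2 (i, j)) Finset.univ p.1‖ ^ 4
        / ((1 + specNorm (Matrix.of fun i j => p.2 (i, j)) ^ 2) ^ 2 * N ^ 4)) := by
  have hS : Measurable fun p : (Fin N → ℂ) × (Fin N × Fin N → ℂ) =>
      specNorm (Matrix.of fun i j => p.2 (i, j)) := measurable_specNorm_of.comp measurable_snd
  have hQ : Measurable fun p : (Fin N → ℂ) × (Fin N × Fin N → ℂ) =>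
      centredQuadForm (Matrix.of fun i j => p.2 (i, j)) Finset.univ p.1 := by
    simp only [centredQuadForm, Matrix.of_apply]
    fun_prop
  exact ((hQ.norm.pow_const 4).div
    ((((hS.pow_const 2).const_add 1).pow_const 2).mul_const _)).ennreal_ofReal

/-- A bound on the partial integrals over one of two independent variables bounds the joint
integral. -/
lemma lintegral_le_of_indepFun {Ω α β : Type*} [MeasurableSpace Ω] [MeasurableSpace α]
    [MeasurableSpace β] {μ : Measure Ω} [IsProbabilityMeasure μ] {X : Ω → α} {Y : Ω → β}
    (hX : Measurable X) (hY : Measurable Y) (hindep : IndepFun X Y μ) {G : α × β → ENNReal}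
    (hG : Measurable G) {c : ENNReal} (hle : ∀ b, ∫⁻ a, G (a, b) ∂(Measure.map X μ) ≤ c) :
    ∫⁻ ω, G (X ω, Y ω) ∂μ ≤ c := by
  have := Measure.isProbabilityMeasure_map (μ := μ) hX.aemeasurable
  have := Measure.isProbabilityMeasure_map (μ := μ) hY.aemeasurable
  rw [← lintegral_map hG (hX.prodMk hY),
    (indepFun_iff_map_prod_eq_prod_map_map hX.aemeasurable hY.aemeasurable).1 hindep,
    lintegral_prod_symm _ hG.aemeasurable]
  exact (lintegral_mono hle).trans_eq (by simp)

/-- For a random matrix independent of the vector, the fourth moment of the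
normalised centred quadratic form, weighted by the spectral norm, is of order `N⁻²`. -/
lemma lintegral_weighted_centredQuadForm_le {Ω : Type*} [MeasurableSpace Ω] {μ : Measure Ω}
    [IsProbabilityMeasure μ] {ν : Measure ℂ} [IsProbabilityMeasure ν]
    (hmean : ∫ z, z ∂ν = 0) (hvar : ∫ z, ‖z‖ ^ 2 ∂ν = 1)
    (hmom8 : Integrable (fun z : ℂ => ‖z‖ ^ 8) ν) {N : ℕ}
    {A : Ω → Matrix (Fin N) (Fin N) ℂ} {x : Ω → Fin N → ℂ} (hx : Measurable x)
    (hA : Measurable fun ω (p : Fin N × Fin N) => A ω p.1 p.2)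
    (hlaw : Measure.map x μ = Measure.pi fun _ : Fin N => ν)
    (hindep : IndepFun x (fun ω (p : Fin N × Fin N) => A ω p.1 p.2) μ) :
    Measurable (fun ω => ENNReal.ofReal
      (‖centredQuadForm (A ω) Finset.univ (x ω)‖ ^ 4 / ((1 + specNorm (A ω) ^ 2) ^ 2 * N ^ 4))) ∧
    ∫⁻ ω, ENNReal.ofReal
      (‖centredQuadForm (A ω) Finset.univ (x ω)‖ ^ 4 / ((1 + specNorm (A ω) ^ 2) ^ 2 * N ^ 4)) ∂μ
      ≤ ENNReal.ofReal ((4 * √(27 * (∫ z, ‖((‖z‖ ^ 2 : ℝ) : ℂ) - 1‖ ^ 4 ∂ν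
        + 32 * (∫ z, ‖z‖ ^ 4 ∂ν) ^ 2))) ^ 2 * (1 / (N : ℝ) ^ 2)) := by
  have hG := measurable_weighted_centredQuadForm N
  have hof ω : (Matrix.of fun i j => A ω i j) = A ω := rfl
  constructor
  · simpa only [Function.comp_def, hof] using hG.comp (hx.prodMk hA)
  · have h := lintegral_le_of_indepFun hx hA hindep hG fun a => by
      rw [hlaw]
      exact lintegral_pi_weighted_centredQuadForm_le hmean hvar hmom8 (Matrix.of fun i j => a (i, j))
    simpa only [hof] using h

/-- Quadratic-form trace lemma: if `x_N` has i.i.d. entries of zero mean, unit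
variance and finite eighth moment (common law `ν`), independent of the random
matrix `A_N` whose spectral norms are almost surely bounded (uniformly in `N`),
then `(1/N) x_Nᴴ A_N x_N − (1/N) tr A_N → 0` almost surely. -/
theorem stmt4 {Ω : Type*} [MeasurableSpace Ω] (μ : Measure Ω) [IsProbabilityMeasure μ]
    (A : ∀ N : ℕ, Ω → Matrix (Fin N) (Fin N) ℂ)
    (x : ∀ N : ℕ, Ω → (Fin N → ℂ))
    (ν : Measure ℂ) [IsProbabilityMeasure ν]
    (hmean : ∫ z, z ∂ν = 0)
    (hvar : ∫ z, ‖z‖ ^ 2 ∂ν = 1)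
    (hmom8 : Integrable (fun z : ℂ => ‖z‖ ^ 8) ν)
    (hxmeas : ∀ N, Measurable (x N))
    (hAmeas : ∀ N, Measurable fun ω (p : Fin N × Fin N) => A N ω p.1 p.2)
    (hxlaw : ∀ N, Measure.map (x N) μ = Measure.pi fun _ : Fin N => ν)
    (hindep : ∀ N, IndepFun (x N) (fun ω (p : Fin N × Fin N) => A N ω p.1 p.2) μ)
    (hbound : ∀ᵐ ω ∂μ, ∃ C : ℝ, ∀ N, specNorm (A N ω) ≤ C) :
    ∀ᵐ ω ∂μ, Tendsto (fun N : ℕ =>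
        (N : ℂ)⁻¹ * (star (x N ω) ⬝ᵥ (A N ω).mulVec (x N ω))
          - (N : ℂ)⁻¹ * Matrix.trace (A N ω))
      atTop (nhds 0) := by
  let w (N : ℕ) (ω : Ω) : ENNReal := ENNReal.ofReal
    (‖centredQuadForm (A N ω) Finset.univ (x N ω)‖ ^ 4
      / ((1 + specNorm (A N ω) ^ 2) ^ 2 * N ^ 4))
  have hw N := lintegral_weighted_centredQuadForm_le hmean hvar hmom8 (hxmeas N) (hAmeas N)
    (hxlaw N) (hindep N)
  have hsum : ∫⁻ ω, ∑' N, w N ω ∂μ ≠ ⊤ := by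
    rw [lintegral_tsum fun N => (hw N).1.aemeasurable]
    refine ne_top_of_le_ne_top ?_ (ENNReal.tsum_le_tsum fun N => (hw N).2)
    exact ((Real.summable_one_div_nat_pow.2 one_lt_two).mul_left _).tsum_ofReal_ne_top
  filter_upwards [ae_lt_top' (AEMeasurable.tsum fun N => (hw N).1.aemeasurable) hsum,
    hbound] with ω hω hC
  obtain ⟨C, hC⟩ := hC
  have hw0 : Tendsto (fun N => (1 + C ^ 2) ^ 2 * (w N ω).toReal) atTop (nhds 0) := by
    simpa using ((ENNReal.tendsto_toReal ENNReal.zero_ne_top).comp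
      (ENNReal.tendsto_atTop_zero_of_tsum_ne_top hω.ne)).const_mul ((1 + C ^ 2) ^ 2)
  have hform (N : ℕ) : (N : ℂ)⁻¹ * (star (x N ω) ⬝ᵥ (A N ω).mulVec (x N ω))
      - (N : ℂ)⁻¹ * Matrix.trace (A N ω)
      = (N : ℂ)⁻¹ * centredQuadForm (A N ω) Finset.univ (x N ω) := by
    simp only [centredQuadForm, dotProduct, Matrix.mulVec, Matrix.trace, Matrix.diag_apply,
      Finset.mul_sum, mul_sub, Pi.star_apply, mul_assoc]
  simp only [hform]
  have hpow : Tendsto (fun N : ℕ => ‖(N : ℂ)⁻¹ * centredQuadForm (A N ω) Finset.univ (x N ω)‖ ^ 4)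
      atTop (nhds 0) := by
    refine squeeze_zero (fun N => by positivity) (fun N => ?_) hw0
    rw [ENNReal.toReal_ofReal (by positivity), ← mul_div_assoc, norm_mul, mul_pow, norm_inv,
      Complex.norm_natCast, mul_comm ((1 + specNorm (A N ω) ^ 2) ^ 2), ← div_div,
      le_div_iff₀ (by positivity), mul_comm ((1 + C ^ 2) ^ 2), mul_div_right_comm,
      div_eq_inv_mul, inv_pow]
    have := specNorm_nonneg (A N ω)
    have := hC N
    gcongr
  have hroot := hpow.sqrt.sqrt
  refine tendsto_zero_iff_norm_tendsto_zero.2 ?_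
  refine (hroot.congr fun N => ?_).trans (by simp)
  rw [show ∀ t : ℝ, t ^ 4 = (t ^ 2) ^ 2 from fun t => by ring, Real.sqrt_sq (by positivity),
    Real.sqrt_sq (norm_nonneg _)]
end
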